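/- arXiv:1712.09949 — 4 statements merged into one kernel-verified Lean document; each statement's English description precedes it below -/
import Mathlib

section
/- Suppose M is an m-dimensional compact manifold that admits an almost formal model (A ⊗ ∧⟨y⟩, dy = z) of index l, where A is a connected CDGA with zero differential, y has degree 1, and z ∈ A_2 with z^l ≠ 0, z^{l+1} = 0. Then A_n = 0 for all n ≥ m. -/
open scoped Manifold

noncomputable section

/-! ## Commutative differential graded algebras over ℝ -/

/-- A commutative differential graded algebra (CDGA) over `ℝ`: a nonnegatively graded
`ℝ`-algebra (the grading being an internal direct sum decomposition) which is
graded-commutative, together with a degree `1` derivation `d` squaring to zero. -/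
structure CDGA where
  carrier : Type
  [ring : Ring carrier]
  [algebra : Algebra ℝ carrier]
  grading : ℕ → Submodule ℝ carrier
  one_mem : (1 : carrier) ∈ grading 0
  mul_mem : ∀ {m n : ℕ} {a b : carrier},
    a ∈ grading m → b ∈ grading n → a * b ∈ grading (m + n)
  internal : DirectSum.IsInternal grading
  gcomm : ∀ {m n : ℕ} {a b : carrier}, a ∈ grading m → b ∈ grading n →
    a * b = ((-1 : ℝ) ^ (m * n)) • (b * a)
  d : carrier →ₗ[ℝ] carrier
  d_mem : ∀ {n : ℕ} {a : carrier}, a ∈ grading n → d a ∈ grading (n + 1)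
  d_d : ∀ a, d (d a) = 0
  leibniz : ∀ {m : ℕ} {a : carrier}, a ∈ grading m → ∀ b,
    d (a * b) = d a * b + ((-1 : ℝ) ^ m) • (a * d b)

attribute [instance] CDGA.ring CDGA.algebra

namespace CDGA

/-- The `n`-cocycles of a CDGA. -/
def cocycles (S : CDGA) (n : ℕ) : Submodule ℝ S.carrier :=
  LinearMap.ker S.d ⊓ S.grading n

/-- The `n`-coboundaries of a CDGA. -/
def coboundaries (S : CDGA) : ℕ → Submodule ℝ S.carrier
  | 0 => ⊥
  | n + 1 => (S.grading n).map S.d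

/-- A CDGA is connected if its degree-0 part is spanned by the unit. -/
def Connected (S : CDGA) : Prop := S.grading 0 = Submodule.span ℝ {(1 : S.carrier)}

end CDGA

/-- The coboundaries of the subcomplex `P` of a CDGA (`P n` is the degree `n` part
of the subcomplex). -/
def subBound (S : CDGA) (P : ℕ → Submodule ℝ S.carrier) : ℕ → Submodule ℝ S.carrier
  | 0 => ⊥
  | n + 1 => (P n).map S.d

/-- A morphism of CDGAs: an `ℝ`-algebra map preserving the grading and commuting
with the differentials. -/
structure CDGAHom (S T : CDGA) where
  toLin : S.carrier →ₗ[ℝ] T.carrier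
  map_one : toLin 1 = 1
  map_mul : ∀ a b, toLin (a * b) = toLin a * toLin b
  map_grading : ∀ {n : ℕ} {a : S.carrier}, a ∈ S.grading n → toLin a ∈ T.grading n
  map_d : ∀ a, toLin (S.d a) = T.d (toLin a)

namespace CDGAHom

/-- A morphism of CDGAs is a quasi-isomorphism if it induces an isomorphism on all
cohomology groups (expressed at the level of cocycles and coboundaries). -/
def IsQuasiIso {S T : CDGA} (φ : CDGAHom S T) : Prop :=
  ∀ n : ℕ,
    (∀ x ∈ S.cocycles n, φ.toLin x ∈ T.coboundaries n → x ∈ S.coboundaries n) ∧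
    (∀ y ∈ T.cocycles n, ∃ x ∈ S.cocycles n, φ.toLin x - y ∈ T.coboundaries n)

/-- A morphism of CDGAs is an isomorphism if it is bijective and identifies the
gradings. -/
def IsIso {S T : CDGA} (φ : CDGAHom S T) : Prop :=
  Function.Bijective φ.toLin ∧ ∀ n, (S.grading n).map φ.toLin = T.grading n

end CDGAHom

/-- There is a direct quasi-isomorphism between two CDGAs. -/
def DirectQIso (S T : CDGA) : Prop := ∃ φ : CDGAHom S T, φ.IsQuasiIso

/-- Two CDGAs are quasi-isomorphic if they are connected by a zigzag of
quasi-isomorphisms. -/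
def QIso : CDGA → CDGA → Prop := Relation.EqvGen DirectQIso

/-! ## Cohomology of a CDGA and induced maps -/

namespace CDGA

/-- Coboundaries viewed inside the `n`-cocycles. -/
def Hsub (S : CDGA) (n : ℕ) : Submodule ℝ ↥(S.cocycles n) :=
  (S.coboundaries n).comap (S.cocycles n).subtype

/-- The degree `n` cohomology of a CDGA. -/
abbrev H (S : CDGA) (n : ℕ) := ↥(S.cocycles n) ⧸ S.Hsub n

end CDGA

namespace CDGAHom

/-- The map induced on cocycles by a CDGA morphism. -/
def cocyclesMap {S T : CDGA} (φ : CDGAHom S T) (n : ℕ) :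
    ↥(S.cocycles n) →ₗ[ℝ] ↥(T.cocycles n) :=
  φ.toLin.restrict (p := S.cocycles n) (q := T.cocycles n) (fun x hx => by
    obtain ⟨h1, h2⟩ := Submodule.mem_inf.mp hx
    refine Submodule.mem_inf.mpr ⟨?_, φ.map_grading h2⟩
    rw [LinearMap.mem_ker] at h1 ⊢
    rw [← φ.map_d, h1, map_zero])

/-- The map induced in cohomology by a CDGA morphism. -/
def Hmap {S T : CDGA} (φ : CDGAHom S T) (n : ℕ) : S.H n →ₗ[ℝ] T.H n :=
  Submodule.mapQ (S.Hsub n) (T.Hsub n) (φ.cocyclesMap n) (by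
    intro x hx
    simp only [CDGA.Hsub, Submodule.mem_comap, Submodule.subtype_apply] at hx ⊢
    have hco : φ.toLin (x : S.carrier) ∈ T.coboundaries n := by
      cases n with
      | zero =>
          simp only [CDGA.coboundaries, Submodule.mem_bot] at hx ⊢
          rw [hx, map_zero]
      | succ n =>
          simp only [CDGA.coboundaries, Submodule.mem_map] at hx ⊢
          obtain ⟨b, hb, hdb⟩ := hx
          exact ⟨φ.toLin b, φ.map_grading hb, by rw [← φ.map_d, hdb]⟩
    exact hco)

end CDGAHom

/-- `ZigzagInduces S T γ` holds when the CDGAs `S` and `T` are connected by a chain of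
quasi-isomorphisms whose induced isomorphism in cohomology is `γ`. -/
inductive ZigzagInduces : ∀ (S T : CDGA), (∀ n, S.H n →ₗ[ℝ] T.H n) → Prop
  | direct {S T : CDGA} (φ : CDGAHom S T) (hφ : φ.IsQuasiIso) : ZigzagInduces S T φ.Hmap
  | symm {S T : CDGA} (γ : ∀ n, S.H n →ₗ[ℝ] T.H n) (γ' : ∀ n, T.H n →ₗ[ℝ] S.H n)
      (h : ZigzagInduces S T γ) (hl : ∀ n x, γ' n (γ n x) = x)
      (hr : ∀ n y, γ n (γ' n y) = y) : ZigzagInduces T S γ'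
  | trans {S T U : CDGA} (γ₁ : ∀ n, S.H n →ₗ[ℝ] T.H n) (γ₂ : ∀ n, T.H n →ₗ[ℝ] U.H n)
      (h₁ : ZigzagInduces S T γ₁) (h₂ : ZigzagInduces T U γ₂) :
      ZigzagInduces S U (fun n => (γ₂ n).comp (γ₁ n))

/-! ## Hirsch extensions -/

/-- `IsHirschExt1 A z E` : `E` is (a model of) the Hirsch extension
`(A ⊗ ∧⟨y⟩, dy = z)` of `A` by one generator `y` of degree 1, characterized by its
universal property. -/
structure IsHirschExt1 (A : CDGA) (z : A.carrier) (E : CDGA) where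
  incl : CDGAHom A E
  y : E.carrier
  y_mem : y ∈ E.grading 1
  dy : E.d y = incl.toLin z
  universal : ∀ (C : CDGA) (ψ : CDGAHom A C) (k : C.carrier),
    k ∈ C.grading 1 → C.d k = ψ.toLin z →
    ∃! Φ : CDGAHom E C, (∀ a, Φ.toLin (incl.toLin a) = ψ.toLin a) ∧ Φ.toLin y = k

/-- `IsHirschExt2 A z E` : `E` is (a model of) the Hirsch extension
`(A ⊗ ∧⟨x, y⟩, dx = 0, dy = z)` of `A` by two generators of degree 1. -/
structure IsHirschExt2 (A : CDGA) (z : A.carrier) (E : CDGA) where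
  incl : CDGAHom A E
  x : E.carrier
  y : E.carrier
  x_mem : x ∈ E.grading 1
  y_mem : y ∈ E.grading 1
  dx : E.d x = 0
  dy : E.d y = incl.toLin z
  universal : ∀ (C : CDGA) (ψ : CDGAHom A C) (kx ky : C.carrier),
    kx ∈ C.grading 1 → ky ∈ C.grading 1 → C.d kx = 0 → C.d ky = ψ.toLin z →
    ∃! Φ : CDGAHom E C, (∀ a, Φ.toLin (incl.toLin a) = ψ.toLin a) ∧
      Φ.toLin x = kx ∧ Φ.toLin y = ky

/-- `IsHirschExtDeg1 A V f E` : `E` is (a model of) the Hirsch extension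
`(A ⊗ ∧V, d_f)` of `A` by the vector space `V` concentrated in degree 1, along the
linear map `f : V → A₂`. -/
structure IsHirschExtDeg1 (A : CDGA) (V : Type) [AddCommGroup V] [Module ℝ V]
    (f : V →ₗ[ℝ] A.carrier) (E : CDGA) where
  incl : CDGAHom A E
  j : V →ₗ[ℝ] E.carrier
  j_mem : ∀ v, j v ∈ E.grading 1
  dj : ∀ v, E.d (j v) = incl.toLin (f v)
  universal : ∀ (C : CDGA) (ψ : CDGAHom A C) (k : V →ₗ[ℝ] C.carrier),
    (∀ v, k v ∈ C.grading 1) → (∀ v, C.d (k v) = ψ.toLin (f v)) →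
    ∃! Φ : CDGAHom E C, (∀ a, Φ.toLin (incl.toLin a) = ψ.toLin a) ∧
      ∀ v, Φ.toLin (j v) = k v

/-- A graded vector space over ℝ. -/
structure GradedVS where
  V : ℕ → Type
  [acg : ∀ n, AddCommGroup (V n)]
  [mod : ∀ n, Module ℝ (V n)]

attribute [instance] GradedVS.acg GradedVS.mod

/-- A `V`-CDGA structure on the CDGA `A`: a degree 1 linear map `f : V → A` with
`d ∘ f = 0`. -/
structure VStr (W : GradedVS) (A : CDGA) where
  f : ∀ n, W.V n →ₗ[ℝ] A.carrier
  f_mem : ∀ n v, f n v ∈ A.grading (n + 1)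
  f_closed : ∀ n v, A.d (f n v) = 0

/-- The map `f^♯ : V → H^{*+1}(A)` induced by a `V`-CDGA structure. -/
def VStr.fsharp {W : GradedVS} {A : CDGA} (F : VStr W A) (n : ℕ) (v : W.V n) :
    A.H (n + 1) :=
  Submodule.Quotient.mk ⟨F.f n v, Submodule.mem_inf.mpr
    ⟨LinearMap.mem_ker.mpr (F.f_closed n v), F.f_mem n v⟩⟩

/-- `IsHirschExt W F E` : `E` is (a model of) the Hirsch extension `(A ⊗ ∧V, d_f)`
of `A` along the `V`-CDGA structure `F`, characterized by its universal property. -/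
structure IsHirschExt (W : GradedVS) {A : CDGA} (F : VStr W A) (E : CDGA) where
  incl : CDGAHom A E
  j : ∀ n, W.V n →ₗ[ℝ] E.carrier
  j_mem : ∀ n v, j n v ∈ E.grading n
  dj : ∀ n v, E.d (j n v) = incl.toLin (F.f n v)
  universal : ∀ (C : CDGA) (ψ : CDGAHom A C) (k : ∀ n, W.V n →ₗ[ℝ] C.carrier),
    (∀ n v, k n v ∈ C.grading n) → (∀ n v, C.d (k n v) = ψ.toLin (F.f n v)) →
    ∃! Φ : CDGAHom E C, (∀ a, Φ.toLin (incl.toLin a) = ψ.toLin a) ∧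
      ∀ n v, Φ.toLin (j n v) = k n v

/-- A CDGA is almost formal of index `l` if it is quasi-isomorphic to a Hirsch
extension `(A ⊗ ∧⟨y⟩, dy = z)` where `A` is a connected CDGA with zero differential
and `z ∈ A₂` satisfies `z^l ≠ 0`, `z^(l+1) = 0`. -/
def AlmostFormalOfIndex (S : CDGA) (l : ℕ) : Prop :=
  ∃ (A : CDGA) (z : A.carrier) (E : CDGA),
    A.Connected ∧ A.d = 0 ∧ z ∈ A.grading 2 ∧ z ^ l ≠ 0 ∧ z ^ (l + 1) = 0 ∧
    Nonempty (IsHirschExt1 A z E) ∧ QIso S E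

/-- `IsCohomologyAlgebraOf S P HB` : the CDGA `HB` (with zero differential) is the
cohomology algebra of the subcomplex `P` of `S`, via the projections `pr n` sending
a cocycle of the subcomplex to its cohomology class. -/
structure IsCohomologyAlgebraOf (S : CDGA) (P : ℕ → Submodule ℝ S.carrier)
    (HB : CDGA) where
  zero_d : HB.d = 0
  pr : ∀ n, ↥(P n ⊓ LinearMap.ker S.d) →ₗ[ℝ] HB.carrier
  pr_mem : ∀ n x, pr n x ∈ HB.grading n
  pr_surj : ∀ n, ∀ h ∈ HB.grading n, ∃ x, pr n x = h
  pr_ker : ∀ n x, pr n x = 0 ↔ (x : S.carrier) ∈ subBound S P n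
  pr_one : ∀ (h : (1 : S.carrier) ∈ P 0 ⊓ LinearMap.ker S.d), pr 0 ⟨1, h⟩ = 1
  pr_mul : ∀ (m n : ℕ) (x : ↥(P m ⊓ LinearMap.ker S.d)) (y : ↥(P n ⊓ LinearMap.ker S.d))
      (h : ((x : S.carrier) * (y : S.carrier)) ∈ P (m + n) ⊓ LinearMap.ker S.d),
      pr (m + n) ⟨(x : S.carrier) * (y : S.carrier), h⟩ = pr m x * pr n y

/-! ## Operations of a Lie algebra in a CDGA -/

/-- The coadjoint action of a Lie algebra on its dual. -/
def coAd {L : Type} [LieRing L] [LieAlgebra ℝ L] (a : L) (α : Module.Dual ℝ L) :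
    Module.Dual ℝ L where
  toFun b := - α ⁅a, b⁆
  map_add' x y := by simp [lie_add]; ring
  map_smul' c x := by simp [lie_smul]

/-- An operation of a Lie algebra `L` in a CDGA `S`: a linear family of degree `-1`
derivations `i x` such that, with `𝓛 x := [i x, d] = i x ∘ d + d ∘ i x`, the usual
identities of Cartan calculus hold. -/
structure Operation (L : Type) [LieRing L] [LieAlgebra ℝ L] (S : CDGA) where
  i : L →ₗ[ℝ] S.carrier →ₗ[ℝ] S.carrier
  i_mem : ∀ (x : L) {n : ℕ} {a : S.carrier}, a ∈ S.grading (n + 1) → i x a ∈ S.grading n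
  i_zero : ∀ (x : L) {a : S.carrier}, a ∈ S.grading 0 → i x a = 0
  i_antider : ∀ (x : L) {m : ℕ} {a : S.carrier}, a ∈ S.grading m → ∀ b,
      i x (a * b) = i x a * b + ((-1 : ℝ) ^ m) • (a * i x b)
  i_sq : ∀ (x : L) (a : S.carrier), i x (i x a) = 0
  lie_lie : ∀ (x y : L) (a : S.carrier),
      (i ⁅x, y⁆ (S.d a) + S.d (i ⁅x, y⁆ a)) =
        (i x (S.d (i y (S.d a) + S.d (i y a))) + S.d (i x (i y (S.d a) + S.d (i y a)))) -
        (i y (S.d (i x (S.d a) + S.d (i x a))) + S.d (i y (i x (S.d a) + S.d (i x a))))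
  i_lie : ∀ (x y : L) (a : S.carrier),
      i ⁅x, y⁆ a = (i x (S.d (i y a)) + S.d (i x (i y a))) - i y (i x (S.d a) + S.d (i x a))

namespace Operation

variable {L : Type} [LieRing L] [LieAlgebra ℝ L] {S : CDGA}

/-- The Lie derivative `𝓛 x = [i x, d]` associated to an operation. -/
def lieD (op : Operation L S) (x : L) : S.carrier →ₗ[ℝ] S.carrier :=
  S.d ∘ₗ op.i x + op.i x ∘ₗ S.d

/-- Elements killed by all the `i x`. -/
def iKer (op : Operation L S) : Submodule ℝ S.carrier :=
  ⨅ x : L, LinearMap.ker (op.i x)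

/-- Elements killed by all the Lie derivatives `𝓛 x`. -/
def lieKer (op : Operation L S) : Submodule ℝ S.carrier :=
  ⨅ x : L, LinearMap.ker (op.lieD x)

end Operation

/-- A degree `-1` derivation of a CDGA. -/
structure DerNeg1 (S : CDGA) where
  D : S.carrier →ₗ[ℝ] S.carrier
  mem : ∀ {n : ℕ} {a : S.carrier}, a ∈ S.grading (n + 1) → D a ∈ S.grading n
  zero : ∀ {a : S.carrier}, a ∈ S.grading 0 → D a = 0
  antider : ∀ {m : ℕ} {a : S.carrier}, a ∈ S.grading m → ∀ b,
      D (a * b) = D a * b + ((-1 : ℝ) ^ m) • (a * D b)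

/-- An algebraic connection for an operation of an (abelian) Lie algebra in a CDGA. -/
structure AlgConnection {L : Type} [LieRing L] [LieAlgebra ℝ L] {S : CDGA}
    (op : Operation L S) where
  χ : Module.Dual ℝ L →ₗ[ℝ] S.carrier
  mem : ∀ α, χ α ∈ S.grading 1
  horizontal : ∀ (a : L) (α), op.i a (χ α) = α a • (1 : S.carrier)
  equivariant : ∀ (a : L) (α),
    op.i a (S.d (χ α)) + S.d (op.i a (χ α)) = χ (coAd a α)

/-! ## An axiomatization of the Cartan calculus of a smooth manifold -/

/-- `CartanCalc M` packages the de Rham algebra `Ω`, the Lie algebra of smooth vector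
fields `X`, interior products, the module structure of functions on vector fields
and the evaluation of functions at points, together with the usual identities of
Cartan calculus, for a smooth manifold with underlying space `M` of dimension
`dim`. -/
structure CartanCalc (M : Type) [TopologicalSpace M] where
  dim : ℕ
  Ω : CDGA
  grading_top : ∀ n, dim < n → Ω.grading n = ⊥
  X : Type
  [xlie : LieRing X]
  [xlalg : LieAlgebra ℝ X]
  smul0 : Ω.carrier →ₗ[ℝ] X →ₗ[ℝ] X
  smul0_one : ∀ v, smul0 1 v = v
  smul0_mul : ∀ (f g : Ω.carrier), f ∈ Ω.grading 0 → g ∈ Ω.grading 0 →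
      ∀ v, smul0 (f * g) v = smul0 f (smul0 g v)
  iprod : X →ₗ[ℝ] Ω.carrier →ₗ[ℝ] Ω.carrier
  iprod_mem : ∀ (v : X) {n : ℕ} {a : Ω.carrier},
      a ∈ Ω.grading (n + 1) → iprod v a ∈ Ω.grading n
  iprod_zero : ∀ (v : X) {a : Ω.carrier}, a ∈ Ω.grading 0 → iprod v a = 0
  iprod_antider : ∀ (v : X) {m : ℕ} {a : Ω.carrier}, a ∈ Ω.grading m → ∀ b,
      iprod v (a * b) = iprod v a * b + ((-1 : ℝ) ^ m) • (a * iprod v b)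
  iprod_sq : ∀ (v : X) (a : Ω.carrier), iprod v (iprod v a) = 0
  iprod_smul0 : ∀ (f : Ω.carrier) (v : X) (a : Ω.carrier), f ∈ Ω.grading 0 →
      iprod (smul0 f v) a = f * iprod v a
  iprod_bracket : ∀ (v w : X) (a : Ω.carrier),
      iprod ⁅v, w⁆ a =
        (iprod v (Ω.d (iprod w a)) + Ω.d (iprod v (iprod w a))) -
          iprod w (iprod v (Ω.d a) + Ω.d (iprod v a))
  ev : Ω.carrier →ₗ[ℝ] (M → ℝ)
  ev_one : ev 1 = fun _ => 1
  ev_mul : ∀ {a b : Ω.carrier}, a ∈ Ω.grading 0 → b ∈ Ω.grading 0 →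
      ev (a * b) = ev a * ev b
  ev_inj : ∀ {a : Ω.carrier}, a ∈ Ω.grading 0 → ev a = 0 → a = 0

attribute [instance] CartanCalc.xlie CartanCalc.xlalg

namespace CartanCalc

variable {M : Type} [TopologicalSpace M]

/-- The Lie derivative along a vector field, via Cartan's magic formula. -/
def lieD (C : CartanCalc M) (v : C.X) : C.Ω.carrier →ₗ[ℝ] C.Ω.carrier :=
  C.Ω.d ∘ₗ C.iprod v + C.iprod v ∘ₗ C.Ω.d

/-- A vector field vanishes at a point if it kills all functions there. -/
def VanishesAt (C : CartanCalc M) (v : C.X) (p : M) : Prop :=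
  ∀ f ∈ C.Ω.grading 0, C.ev (C.lieD v f) p = 0

/-- The basic subcomplex determined by a family `vs` of vector fields:
forms killed by all interior products and Lie derivatives along members of `vs`. -/
def basicSub (C : CartanCalc M) (vs : Set C.X) (n : ℕ) : Submodule ℝ C.Ω.carrier :=
  C.Ω.grading n ⊓ (⨅ v ∈ vs, LinearMap.ker (C.iprod v)) ⊓
    ⨅ v ∈ vs, LinearMap.ker (C.lieD v)

/-- The invariant subcomplex determined by a family `vs` of vector fields:
forms killed by all Lie derivatives along members of `vs`. -/
def invSub (C : CartanCalc M) (vs : Set C.X) (n : ℕ) : Submodule ℝ C.Ω.carrier :=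
  C.Ω.grading n ⊓ ⨅ v ∈ vs, LinearMap.ker (C.lieD v)

end CartanCalc

/-- A Riemannian metric, in the axiomatized Cartan calculus. -/
structure RMetric {M : Type} [TopologicalSpace M] (C : CartanCalc M) where
  g : C.X →ₗ[ℝ] C.X →ₗ[ℝ] C.Ω.carrier
  g_mem : ∀ v w, g v w ∈ C.Ω.grading 0
  g_symm : ∀ v w, g v w = g w v
  g_smul0 : ∀ (f : C.Ω.carrier) (v w : C.X), f ∈ C.Ω.grading 0 →
      g (C.smul0 f v) w = f * g v w
  g_pos : ∀ (v : C.X) (p : M), ¬ C.VanishesAt v p → 0 < C.ev (g v v) p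
  g_nondeg : ∀ v, (∀ w, g v w = 0) → v = 0

/-- A vector field is Killing if the Lie derivative of the metric along it vanishes. -/
def RMetric.IsKilling {M : Type} [TopologicalSpace M] {C : CartanCalc M}
    (gm : RMetric C) (v : C.X) : Prop :=
  ∀ w z : C.X, C.lieD v (gm.g w z) = gm.g ⁅v, w⁆ z + gm.g w ⁅v, z⁆

/-! ## Almost contact metric structures -/

/-- An almost contact metric structure `(φ, ξ, η, h)` together with its fundamental
2-form `Φ₂`. -/
structure AlmostContactMetric {M : Type} [TopologicalSpace M] (C : CartanCalc M) where
  gm : RMetric C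
  φ : C.X →ₗ[ℝ] C.X
  ξ : C.X
  η : C.Ω.carrier
  η_mem : η ∈ C.Ω.grading 1
  φ_sq : ∀ v, φ (φ v) = -v + C.smul0 (C.iprod v η) ξ
  η_ξ : C.iprod ξ η = 1
  η_dual : ∀ v, C.iprod v η = gm.g v ξ
  compat : ∀ v w, gm.g (φ v) (φ w) = gm.g v w - C.iprod v η * C.iprod w η
  Φ2 : C.Ω.carrier
  Φ2_mem : Φ2 ∈ C.Ω.grading 2
  Φ2_eval : ∀ v w, C.iprod w (C.iprod v Φ2) = gm.g v (φ w)

namespace AlmostContactMetric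

variable {M : Type} [TopologicalSpace M] {C : CartanCalc M}

/-- Normality: `N_φ + dη ⊗ ξ = 0`. -/
def Normal (s : AlmostContactMetric C) : Prop :=
  ∀ v w : C.X,
    s.φ (s.φ ⁅v, w⁆) + ⁅s.φ v, s.φ w⁆ - s.φ ⁅s.φ v, w⁆ - s.φ ⁅v, s.φ w⁆
      + C.smul0 (C.iprod w (C.iprod v (C.Ω.d s.η))) s.ξ = 0

/-- Quasi-Sasakian: normal and with closed fundamental 2-form. -/
def QuasiSasakian (s : AlmostContactMetric C) : Prop :=
  s.Normal ∧ C.Ω.d s.Φ2 = 0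

/-- Sasakian: normal and `dη = Φ`. -/
def Sasakian (s : AlmostContactMetric C) : Prop :=
  s.Normal ∧ C.Ω.d s.η = s.Φ2

end AlmostContactMetric

/-- The index of a quasi-Sasakian structure: the natural number `l` with
`[dη]_B^l ≠ 0` and `[dη]_B^{l+1} = 0` in the basic cohomology of the foliation
generated by the Reeb vector field. -/
def QSIndex {M : Type} [TopologicalSpace M] {C : CartanCalc M}
    (s : AlmostContactMetric C) (l : ℕ) : Prop :=
  (C.Ω.d s.η) ^ l ∉ subBound C.Ω (C.basicSub {s.ξ}) (2 * l) ∧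
    (C.Ω.d s.η) ^ (l + 1) ∈ subBound C.Ω (C.basicSub {s.ξ}) (2 * l + 2)

/-! ## Hermitian, quasi-Vaisman and Vaisman structures -/

/-- A Hermitian structure `(J, g)` with its fundamental 2-form `Ω₂`. -/
structure HermitianStr {M : Type} [TopologicalSpace M] (C : CartanCalc M) where
  gm : RMetric C
  J : C.X →ₗ[ℝ] C.X
  J_sq : ∀ v, J (J v) = -v
  compat : ∀ v w, gm.g (J v) (J w) = gm.g v w
  integrable : ∀ v w, ⁅J v, J w⁆ - J ⁅J v, w⁆ - J ⁅v, J w⁆ - ⁅v, w⁆ = 0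
  Ω2 : C.Ω.carrier
  Ω2_mem : Ω2 ∈ C.Ω.grading 2
  Ω2_eval : ∀ v w, C.iprod w (C.iprod v Ω2) = gm.g v (J w)

/-- A quasi-Vaisman structure: a Hermitian structure `(J, g)` together with a closed
1-form `θ` whose metric dual `U` is unitary, Killing and holomorphic, such that
`dΩ = dη ∧ θ` where `η = -θ ∘ J`; `V` is the metric dual of `η`. -/
structure QuasiVaismanStr {M : Type} [TopologicalSpace M] (C : CartanCalc M) where
  herm : HermitianStr C
  θ : C.Ω.carrier
  θ_mem : θ ∈ C.Ω.grading 1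
  θ_closed : C.Ω.d θ = 0
  U : C.X
  U_dual : ∀ w, C.iprod w θ = herm.gm.g U w
  U_unit : herm.gm.g U U = 1
  U_killing : herm.gm.IsKilling U
  U_hol : ∀ w, ⁅U, herm.J w⁆ = herm.J ⁅U, w⁆
  η : C.Ω.carrier
  η_mem : η ∈ C.Ω.grading 1
  η_eval : ∀ w, C.iprod w η = - C.iprod (herm.J w) θ
  V : C.X
  V_dual : ∀ w, C.iprod w η = herm.gm.g V w
  dΩ_eq : C.Ω.d herm.Ω2 = C.Ω.d η * θ

/-- A Vaisman structure: a locally conformal Kähler structure (`dΩ = Ω ∧ θ` with `θ`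
closed) whose Lee form `θ` is parallel; since `θ` is closed and of constant unit
norm, parallelism of `θ` is equivalent to its metric dual `U` being Killing. -/
structure VaismanStr {M : Type} [TopologicalSpace M] (C : CartanCalc M) where
  herm : HermitianStr C
  θ : C.Ω.carrier
  θ_mem : θ ∈ C.Ω.grading 1
  θ_closed : C.Ω.d θ = 0
  lck : C.Ω.d herm.Ω2 = herm.Ω2 * θ
  U : C.X
  U_dual : ∀ w, C.iprod w θ = herm.gm.g U w
  U_unit : herm.gm.g U U = 1
  U_killing : herm.gm.IsKilling U

/-- The index of a quasi-Vaisman structure. -/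
def QVIndex {M : Type} [TopologicalSpace M] {C : CartanCalc M}
    (s : QuasiVaismanStr C) (l : ℕ) : Prop :=
  (C.Ω.d s.η) ^ l ∉ subBound C.Ω (C.basicSub {s.U, s.V}) (2 * l) ∧
    (C.Ω.d s.η) ^ (l + 1) ∈ subBound C.Ω (C.basicSub {s.U, s.V}) (2 * l + 2)

/-- The data relating the Cartan calculus of `M` to the Cartan calculus of the
product of `M` with a line (or a circle): the lift of vector fields, the pullback of
forms, the canonical vector field `E = ∂/∂t` of the second factor and its dual
closed 1-form `dt`. -/
structure ProductWithLine {M M' : Type} [TopologicalSpace M] [TopologicalSpace M']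
    (C : CartanCalc M) (C' : CartanCalc M') where
  liftX : C.X →ₗ[ℝ] C'.X
  liftΩ : CDGAHom C.Ω C'.Ω
  E : C'.X
  dt : C'.Ω.carrier
  dt_mem : dt ∈ C'.Ω.grading 1
  dt_closed : C'.Ω.d dt = 0
  iE_dt : C'.iprod E dt = 1
  iX_dt : ∀ v, C'.iprod (liftX v) dt = 0
  bracket_lift : ∀ v w, ⁅liftX v, liftX w⁆ = liftX ⁅v, w⁆
  bracket_E : ∀ v, ⁅E, liftX v⁆ = 0
  i_lift : ∀ v a, C'.iprod (liftX v) (liftΩ.toLin a) = liftΩ.toLin (C.iprod v a)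
  iE_lift : ∀ a, C'.iprod E (liftΩ.toLin a) = 0

/-! ## The generalized Heisenberg groups -/

/-- The generalized Heisenberg group `H(1, l)` of upper unitriangular matrices with
top row `p ∈ ℝ^l`, last column `q ∈ ℝ^l` and corner entry `t`. -/
@[ext]
structure Heisenberg (l : ℕ) where
  p : Fin l → ℝ
  q : Fin l → ℝ
  t : ℝ

namespace Heisenberg

variable {l : ℕ}

instance : Mul (Heisenberg l) :=
  ⟨fun a b => ⟨a.p + b.p, a.q + b.q, a.t + b.t + ∑ i, a.p i * b.q i⟩⟩

instance : One (Heisenberg l) := ⟨⟨0, 0, 0⟩⟩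

instance : Inv (Heisenberg l) :=
  ⟨fun a => ⟨-a.p, -a.q, -a.t + ∑ i, a.p i * a.q i⟩⟩

@[simp] theorem mul_p (a b : Heisenberg l) : (a * b).p = a.p + b.p := rfl
@[simp] theorem mul_q (a b : Heisenberg l) : (a * b).q = a.q + b.q := rfl
@[simp] theorem mul_t (a b : Heisenberg l) :
    (a * b).t = a.t + b.t + ∑ i, a.p i * b.q i := rfl
@[simp] theorem one_p : (1 : Heisenberg l).p = 0 := rfl
@[simp] theorem one_q : (1 : Heisenberg l).q = 0 := rfl
@[simp] theorem one_t : (1 : Heisenberg l).t = 0 := rfl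
@[simp] theorem inv_p (a : Heisenberg l) : a⁻¹.p = -a.p := rfl
@[simp] theorem inv_q (a : Heisenberg l) : a⁻¹.q = -a.q := rfl
@[simp] theorem inv_t (a : Heisenberg l) :
    a⁻¹.t = -a.t + ∑ i, a.p i * a.q i := rfl

instance : Group (Heisenberg l) where
  mul_assoc a b c := by
    ext
    · simp [add_assoc]
    · simp [add_assoc]
    · simp only [mul_t, mul_p, mul_q, Pi.add_apply, add_mul, mul_add,
        Finset.sum_add_distrib]
      ring
  one_mul a := by ext <;> simp
  mul_one a := by ext <;> simp
  inv_mul_cancel a := by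
    ext
    · simp
    · simp
    · simp only [mul_t, inv_t, inv_p, Pi.neg_apply, neg_mul, one_t,
        Finset.sum_neg_distrib]
      ring

instance : TopologicalSpace (Heisenberg l) :=
  TopologicalSpace.induced (fun a => (a.p, a.q, a.t)) inferInstance

end Heisenberg

/-- Two topological groups are isomorphic as Lie groups (for 1-connected Lie groups
a continuous group isomorphism is automatically an isomorphism of Lie groups). -/
def IsoAsLieGroups (G H : Type) [Group G] [Group H] [TopologicalSpace G]
    [TopologicalSpace H] : Prop :=
  ∃ e : G ≃* H, Continuous e ∧ Continuous e.symm


namespace Stmt7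

theorem exists_glue (A : CDGA) (f : ℕ → A.carrier →ₗ[ℝ] A.carrier) :
    ∃ g : A.carrier →ₗ[ℝ] A.carrier, ∀ n, ∀ a ∈ A.grading n, g a = f n a := by
  classical
  let e := LinearEquiv.ofBijective (DirectSum.coeLinearMap A.grading) A.internal
  refine ⟨(DirectSum.toModule ℝ ℕ A.carrier (fun n => f n ∘ₗ (A.grading n).subtype)) ∘ₗ
    e.symm.toLinearMap, ?_⟩
  intro n a ha
  have h : e.symm a = DirectSum.lof ℝ ℕ (fun i => A.grading i) n ⟨a, ha⟩ := by
    rw [LinearEquiv.symm_apply_eq]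
    exact (DirectSum.coeLinearMap_lof A.grading n ⟨a, ha⟩).symm
  simp [h]

theorem iSup_top (A : CDGA) : ⨆ n, A.grading n = ⊤ := by
  classical
  exact (DirectSum.isInternal_submodule_iff_iSupIndep_and_iSup_eq_top A.grading).1 A.internal |>.2

theorem graded_induction (A : CDGA) {p : A.carrier → Prop}
    (h : ∀ n, ∀ a ∈ A.grading n, p a) (h0 : p 0) (hadd : ∀ a b, p a → p b → p (a + b))
    (a : A.carrier) : p a := by
  have ha : a ∈ ⨆ n, A.grading n := by rw [iSup_top]; trivial
  exact Submodule.iSup_induction A.grading (motive := p) ha h h0 hadd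

theorem isInternal_of_proj {V : Type} [AddCommGroup V] [Module ℝ V] (G : ℕ → Submodule ℝ V)
    (p : ℕ → V →ₗ[ℝ] V) (h1 : ∀ n, ∀ x ∈ G n, p n x = x)
    (h2 : ∀ n k, k ≠ n → ∀ x ∈ G k, p n x = 0) (htop : ⨆ n, G n = ⊤) :
    DirectSum.IsInternal G := by
  classical
  refine (DirectSum.isInternal_submodule_iff_iSupIndep_and_iSup_eq_top G).2 ⟨?_, htop⟩
  rw [iSupIndep_def]
  intro n
  rw [Submodule.disjoint_def]
  intro x hx hxs
  have hle : (⨆ k, ⨆ (_ : k ≠ n), G k) ≤ LinearMap.ker (p n) := by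
    refine iSup_le fun k => iSup_le fun hk => fun y hy => ?_
    exact LinearMap.mem_ker.2 (h2 n k hk y hy)
  rw [← h1 n x hx]
  exact LinearMap.mem_ker.1 (hle hxs)

/-- The grading involution. -/
def sg (A : CDGA) : A.carrier →ₗ[ℝ] A.carrier :=
  (exists_glue A (fun n => ((-1 : ℝ) ^ n) • LinearMap.id)).choose

theorem sg_of {A : CDGA} {n : ℕ} {a : A.carrier} (ha : a ∈ A.grading n) :
    sg A a = ((-1 : ℝ) ^ n) • a := by
  have := (exists_glue A (fun n => ((-1 : ℝ) ^ n) • LinearMap.id)).choose_spec n a ha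
  exact this

theorem sg_one (A : CDGA) : sg A 1 = 1 := by
  simpa using sg_of A.one_mem

theorem sg_mem {A : CDGA} {n : ℕ} {a : A.carrier} (ha : a ∈ A.grading n) :
    sg A a ∈ A.grading n := by
  rw [sg_of ha]; exact Submodule.smul_mem _ _ ha

theorem sg_sg (A : CDGA) (a : A.carrier) : sg A (sg A a) = a := by
  refine graded_induction A (p := fun a => sg A (sg A a) = a) ?_ (by simp) ?_ a
  · intro n a ha
    rw [sg_of ha, map_smul, sg_of ha, smul_smul, ← mul_pow]; simp
  · intro a b h hh
    simp [h, hh]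

theorem sg_mul (A : CDGA) (a b : A.carrier) : sg A (a * b) = sg A a * sg A b := by
  refine graded_induction A (p := fun a => sg A (a * b) = sg A a * sg A b) ?_ (by simp) ?_ a
  · intro m a ha
    refine graded_induction A (p := fun b => sg A (a * b) = sg A a * sg A b) ?_ (by simp) ?_ b
    · intro n b hb
      rw [sg_of ha, sg_of hb, sg_of (A.mul_mem ha hb), smul_mul_smul_comm, pow_add]
    · intro x y hx hy
      simp [mul_add, hx, hy]
  · intro x y hx hy
    simp [add_mul, hx, hy]

theorem central {A : CDGA} {z : A.carrier} (hz : z ∈ A.grading 2) (a : A.carrier) :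
    z * a = a * z := by
  refine graded_induction A (p := fun a => z * a = a * z) ?_ (by simp) ?_ a
  · intro n a ha
    rw [A.gcomm hz ha, pow_mul]; simp
  · intro x y hx hy
    simp [add_mul, mul_add, hx, hy]

/-- The underlying space of the extension: `(a, b)` stands for `a + b y`. -/
def HC (A : CDGA) : Type := A.carrier × A.carrier

instance (A : CDGA) : AddCommGroup (HC A) :=
  inferInstanceAs (AddCommGroup (A.carrier × A.carrier))

instance modHC (A : CDGA) : Module ℝ (HC A) :=
  inferInstanceAs (Module ℝ (A.carrier × A.carrier))

instance (A : CDGA) : Mul (HC A) := ⟨fun u v => (u.1 * v.1, u.1 * v.2 + u.2 * sg A v.1)⟩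

instance (A : CDGA) : One (HC A) := ⟨((1 : A.carrier), (0 : A.carrier))⟩

variable {A : CDGA}

/-- The element `a + b y`. -/
def mk (a b : A.carrier) : HC A := (a, b)

theorem HC.ext {u v : HC A} (h1 : u.1 = v.1) (h2 : u.2 = v.2) : u = v := Prod.ext h1 h2
theorem mul_fst (u v : HC A) : (u * v).1 = u.1 * v.1 := rfl
theorem mul_snd (u v : HC A) : (u * v).2 = u.1 * v.2 + u.2 * sg A v.1 := rfl
theorem one_fst : (1 : HC A).1 = 1 := rfl
theorem one_snd : (1 : HC A).2 = 0 := rfl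
theorem add_fst (u v : HC A) : (u + v).1 = u.1 + v.1 := rfl
theorem add_snd (u v : HC A) : (u + v).2 = u.2 + v.2 := rfl
theorem zero_fst : (0 : HC A).1 = 0 := rfl
theorem zero_snd : (0 : HC A).2 = 0 := rfl
theorem smul_fst (c : ℝ) (u : HC A) : (c • u).1 = c • u.1 := rfl
theorem smul_snd (c : ℝ) (u : HC A) : (c • u).2 = c • u.2 := rfl

instance ringHC (A : CDGA) : Ring (HC A) :=
  { (inferInstance : AddCommGroup (HC A)),
    (inferInstance : Mul (HC A)), (inferInstance : One (HC A)) with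
    left_distrib := fun a b c => by
      apply HC.ext <;> simp only [mul_fst, mul_snd, add_fst, add_snd, mul_add, map_add]; abel
    right_distrib := fun a b c => by
      apply HC.ext <;> simp only [mul_fst, mul_snd, add_fst, add_snd, add_mul]; abel
    zero_mul := fun a => by
      apply HC.ext <;> simp [mul_fst, mul_snd, zero_fst, zero_snd]
    mul_zero := fun a => by
      apply HC.ext <;> simp [mul_fst, mul_snd, zero_fst, zero_snd]
    mul_assoc := fun a b c => by
      apply HC.ext <;> simp [mul_fst, mul_snd, sg_mul, mul_assoc, mul_add, add_mul, add_assoc]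
    one_mul := fun a => by
      apply HC.ext <;> simp [mul_fst, mul_snd, one_fst, one_snd]
    mul_one := fun a => by
      apply HC.ext <;> simp [mul_fst, mul_snd, one_fst, one_snd, sg_one] }

instance algHC (A : CDGA) : Algebra ℝ (HC A) :=
  Algebra.ofModule
    (fun r x y => by
      apply HC.ext <;> simp [mul_fst, mul_snd, smul_fst, smul_snd])
    (fun r x y => by
      apply HC.ext <;> simp [mul_fst, mul_snd, smul_fst, smul_snd])

/-- The shifted grading. -/
def shG (A : CDGA) : ℕ → Submodule ℝ A.carrier
  | 0 => ⊥
  | n + 1 => A.grading n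

def gr (A : CDGA) (n : ℕ) : Submodule ℝ (HC A) :=
  Submodule.prod (A.grading n) (shG A n)

theorem mem_gr {n : ℕ} {u : HC A} : u ∈ gr A n ↔ u.1 ∈ A.grading n ∧ u.2 ∈ shG A n := Iff.rfl

theorem exists_proj (A : CDGA) (n : ℕ) : ∃ g : A.carrier →ₗ[ℝ] A.carrier,
    (∀ x ∈ A.grading n, g x = x) ∧ ∀ k, k ≠ n → ∀ x ∈ A.grading k, g x = 0 := by
  classical
  obtain ⟨g, hg⟩ := exists_glue A (fun k => if k = n then LinearMap.id else 0)
  refine ⟨g, fun x hx => by simp [hg n x hx], fun k hk x hx => by simp [hg k x hx, hk]⟩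

theorem exists_proj_sh (A : CDGA) (n : ℕ) : ∃ g : A.carrier →ₗ[ℝ] A.carrier,
    (∀ x ∈ shG A n, g x = x) ∧ ∀ k, k ≠ n → ∀ x ∈ shG A k, g x = 0 := by
  cases n with
  | zero =>
    refine ⟨0, fun x hx => ?_, fun k hk x hx => rfl⟩
    simp only [shG, Submodule.mem_bot] at hx
    simp [hx]
  | succ n =>
    obtain ⟨g, h1, h2⟩ := exists_proj A n
    refine ⟨g, h1, fun k hk x hx => ?_⟩
    cases k with
    | zero =>
      simp only [shG, Submodule.mem_bot] at hx
      simp [hx]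
    | succ k => exact h2 k (by omega) x hx

theorem gr_internal (A : CDGA) : DirectSum.IsInternal (gr A) := by
  choose p hp1 hp2 using exists_proj A
  choose q hq1 hq2 using exists_proj_sh A
  refine isInternal_of_proj (gr A) (fun n => LinearMap.prodMap (p n) (q n)) ?_ ?_ ?_
  · intro n x hx
    exact HC.ext (hp1 n _ hx.1) (hq1 n _ hx.2)
  · intro n k hk x hx
    exact HC.ext (hp2 n k hk _ hx.1) (hq2 n k hk _ hx.2)
  · rw [eq_top_iff]
    intro x _
    have h1 : ∀ a : A.carrier, mk a 0 ∈ ⨆ n, gr A n := by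
      intro a
      refine graded_induction A (p := fun a => mk (a) (0) ∈ ⨆ n, gr A n) ?_ ?_ ?_ a
      · intro n a ha
        exact Submodule.mem_iSup_of_mem n ⟨ha, Submodule.zero_mem _⟩
      · exact Submodule.zero_mem _
      · intro a b ha hb
        have := Submodule.add_mem _ ha hb
        have e : mk (a) (0) + mk (b) (0) = mk (a + b) (0) :=
          HC.ext rfl (add_zero _)
        rwa [e] at this
    have h2 : ∀ a : A.carrier, mk (0) (a) ∈ ⨆ n, gr A n := by
      intro a
      refine graded_induction A (p := fun a => mk (0) (a) ∈ ⨆ n, gr A n) ?_ ?_ ?_ a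
      · intro n a ha
        exact Submodule.mem_iSup_of_mem (n + 1) ⟨Submodule.zero_mem _, ha⟩
      · exact Submodule.zero_mem _
      · intro a b ha hb
        have := Submodule.add_mem _ ha hb
        have e : mk (0) (a) + mk (0) (b) = mk (0) (a + b) :=
          HC.ext (add_zero _) rfl
        rwa [e] at this
    have := Submodule.add_mem _ (h1 x.1) (h2 x.2)
    have e : mk (x.1) (0) + mk (0) (x.2) = x :=
      HC.ext (add_zero _) (zero_add _)
    rwa [e] at this

def dHC (A : CDGA) (z : A.carrier) : HC A →ₗ[ℝ] HC A where
  toFun u := (sg A u.2 * z, 0)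
  map_add' u v := by
    refine HC.ext ?_ ?_
    · change sg A (u.2 + v.2) * z = sg A u.2 * z + sg A v.2 * z
      simp [add_mul]
    · exact (add_zero _).symm
  map_smul' c u := by
    refine HC.ext ?_ ?_
    · change sg A (c • u.2) * z = c • (sg A u.2 * z)
      simp
    · exact (smul_zero _).symm

theorem d_fst (z : A.carrier) (u : HC A) : (dHC A z u).1 = sg A u.2 * z := rfl
theorem d_snd (z : A.carrier) (u : HC A) : (dHC A z u).2 = 0 := rfl

theorem sg_sh {n : ℕ} {b : A.carrier} (hb : b ∈ shG A n) : sg A b = -(((-1 : ℝ) ^ n) • b) := by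
  cases n with
  | zero =>
    simp only [shG, Submodule.mem_bot] at hb
    simp [hb]
  | succ n =>
    rw [sg_of (n := n) hb, pow_succ]; simp

theorem mul_sh {m n : ℕ} {a b : A.carrier} (ha : a ∈ A.grading m) (hb : b ∈ shG A n) :
    a * b ∈ shG A (m + n) := by
  cases n with
  | zero =>
    simp only [shG, Submodule.mem_bot] at hb
    simp [hb]
  | succ n => exact A.mul_mem (n := n) ha hb

theorem sh_mul {m n : ℕ} {a b : A.carrier} (ha : a ∈ shG A m) (hb : b ∈ A.grading n) :
    a * b ∈ shG A (m + n) := by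
  cases m with
  | zero =>
    simp only [shG, Submodule.mem_bot] at ha
    simp [ha]
  | succ m =>
    rw [Nat.add_right_comm]
    exact A.mul_mem (m := m) ha hb

theorem comm_sh {m n : ℕ} {a b : A.carrier} (ha : a ∈ A.grading m) (hb : b ∈ shG A n) :
    a * b = ((-1 : ℝ) ^ (m * n + m)) • (b * a) := by
  cases n with
  | zero =>
    simp only [shG, Submodule.mem_bot] at hb
    simp [hb]
  | succ n =>
    rw [A.gcomm (n := n) ha hb]
    congr 1
    rw [show m * (n + 1) + m = m * n + 2 * m by ring, pow_add, pow_mul (-1) 2 m]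
    simp

theorem neg_one_sq_pow (k : ℕ) : ((-1 : ℝ) ^ k) * ((-1 : ℝ) ^ k) = 1 := by
  rw [← mul_pow]; simp

/-- An explicit model of the Hirsch extension. -/
def model (A : CDGA) (z : A.carrier) (hz : z ∈ A.grading 2) : CDGA where
  carrier := HC A
  grading := gr A
  one_mem := ⟨A.one_mem, Submodule.zero_mem _⟩
  mul_mem := by
    intro m n a b ha hb
    exact ⟨A.mul_mem ha.1 hb.1,
      Submodule.add_mem _ (mul_sh ha.1 hb.2) (sh_mul ha.2 (sg_mem hb.1))⟩
  internal := gr_internal A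
  gcomm := by
    intro m n u v hu hv
    refine HC.ext ?_ ?_
    · exact A.gcomm hu.1 hv.1
    · have e1 := comm_sh hu.1 hv.2
      have e2 := comm_sh hv.1 hu.2
      change u.1 * v.2 + u.2 * sg A v.1 = ((-1 : ℝ) ^ (m * n)) • (v.1 * u.2 + v.2 * sg A u.1)
      rw [sg_of hv.1, sg_of hu.1, e1, e2]
      simp only [mul_smul_comm, smul_add, smul_smul]
      rw [add_comm]
      congr 1
      · congr 1
        rw [mul_comm n m, pow_add, ← mul_assoc, neg_one_sq_pow, one_mul]
      · rw [← pow_add]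
  d := dHC A z
  d_mem := by
    intro n u hu
    refine ⟨?_, Submodule.zero_mem _⟩
    rw [d_fst]
    cases n with
    | zero =>
      have h : u.2 = 0 := hu.2
      simp [h]
    | succ n => exact A.mul_mem (m := n) (n := 2) (sg_mem (n := n) hu.2) hz
  d_d := by
    intro u
    refine HC.ext ?_ rfl
    rw [d_fst, d_snd]
    simp [zero_fst]
  leibniz := by
    intro m u hu v
    have hzz : sg A z = z := by simpa using sg_of hz
    refine HC.ext ?_ ?_
    · rw [d_fst, add_fst, smul_fst, mul_fst, mul_fst, mul_snd, d_fst, d_fst]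
      rw [map_add, sg_mul, sg_mul, sg_sg, sg_of hu.1, add_mul, mul_assoc (sg A u.2) z, central hz,
        add_comm]
      simp [mul_assoc]
    · rw [d_snd, add_snd, smul_snd, mul_snd, mul_snd, d_snd, d_snd, d_fst, d_fst]
      rw [sg_mul, sg_sg, hzz, sg_sh hu.2, mul_assoc, central hz]
      simp

def modelIncl (A : CDGA) (hd : A.d = 0) (z : A.carrier) (hz : z ∈ A.grading 2) :
    CDGAHom A (model A z hz) where
  toLin := LinearMap.inl ℝ A.carrier A.carrier
  map_one := rfl
  map_mul a b := by
    refine HC.ext rfl ?_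
    change (0 : A.carrier) = a * 0 + 0 * sg A b
    simp
  map_grading ha := ⟨ha, Submodule.zero_mem _⟩
  map_d a := by
    refine HC.ext ?_ rfl
    change A.d a = sg A 0 * z
    simp [hd]

theorem not_cobound {E : CDGA} (hd : A.d = 0) {z : A.carrier} (hz : z ∈ A.grading 2)
    (hE : IsHirschExt1 A z E) {w : A.carrier} {f : E.carrier}
    (h : E.d f = hE.incl.toLin w * hE.y) : w = 0 := by
  obtain ⟨Φ, ⟨h1, h2⟩, -⟩ := hE.universal (model A z hz) (modelIncl A hd z hz)
    (((0 : A.carrier), (1 : A.carrier)) : HC A) ⟨Submodule.zero_mem _, A.one_mem⟩ (by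
      refine HC.ext ?_ rfl
      change sg A 1 * z = z
      simp [sg_one])
  have h3 := Φ.map_d f
  rw [h, Φ.map_mul, h1, h2] at h3
  have h4 : w * 1 + 0 * sg A 0 = 0 := congrArg Prod.snd h3
  simpa using h4

/-- Cohomology vanishes in degrees above `m`. -/
def Van (m : ℕ) (S : CDGA) : Prop := ∀ n, m < n → S.cocycles n ≤ S.coboundaries n

theorem van_iff {m : ℕ} {S T : CDGA} (φ : CDGAHom S T) (h : φ.IsQuasiIso) :
    Van m S ↔ Van m T := by
  constructor
  · intro hS n hn y hy
    obtain ⟨x, hx, hxy⟩ := (h n).2 y hy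
    have hb := hS n hn hx
    cases n with
    | zero => omega
    | succ n =>
      obtain ⟨b, hb, rfl⟩ := hb
      have : φ.toLin (S.d b) ∈ T.coboundaries (n + 1) :=
        ⟨φ.toLin b, φ.map_grading hb, (φ.map_d b).symm⟩
      have := Submodule.sub_mem _ this hxy
      simpa using this
  · intro hT n hn x hx
    exact (h n).1 x hx (hT n hn (φ.cocyclesMap n ⟨x, hx⟩).2)

theorem van_qiso {m : ℕ} {S T : CDGA} (h : QIso S T) : Van m S ↔ Van m T := by
  induction h with
  | rel _ _ h => obtain ⟨φ, hφ⟩ := h; exact van_iff φ hφ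
  | refl => exact Iff.rfl
  | symm _ _ _ ih => exact ih.symm
  | trans _ _ _ _ _ ih1 ih2 => exact ih1.trans ih2

theorem key {E : CDGA} (hd : A.d = 0) {z : A.carrier} (hz : z ∈ A.grading 2)
    (hE : IsHirschExt1 A z E) {m : ℕ} (hv : Van m E) {n : ℕ} (hn : m ≤ n) {w : A.carrier}
    (hw : w ∈ A.grading n) (hwz : w * z = 0) : w = 0 := by
  have hc : hE.incl.toLin w * hE.y ∈ E.cocycles (n + 1) := by
    refine ⟨?_, E.mul_mem (hE.incl.map_grading hw) hE.y_mem⟩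
    change E.d _ = 0
    rw [E.leibniz (hE.incl.map_grading hw), ← hE.incl.map_d, hd, hE.dy, ← hE.incl.map_mul, hwz]
    simp
  obtain ⟨f, -, hf⟩ := hv (n + 1) (by omega) hc
  exact not_cobound hd hz hE hf

theorem key_pow {E : CDGA} (hd : A.d = 0) {z : A.carrier} (hz : z ∈ A.grading 2)
    (hE : IsHirschExt1 A z E) {m : ℕ} (hv : Van m E) (k : ℕ) : ∀ {n : ℕ} (_ : m ≤ n)
    {w : A.carrier} (_ : w ∈ A.grading n) (_ : w * z ^ k = 0), w = 0 := by
  induction k with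
  | zero => intro n hn w hw h; simpa using h
  | succ k ih =>
    intro n hn w hw h
    refine key hd hz hE hv hn hw (ih (n := n + 2) (by omega) (A.mul_mem hw hz) ?_)
    rw [mul_assoc, ← pow_succ', h]

end Stmt7

/-- if a compact `m`-dimensional manifold admits an almost formal model
`(A ⊗ ∧⟨y⟩, dy = z)` of index `l`, then `A_n = 0` for all `n ≥ m`. -/
theorem statement7 {M : Type} [TopologicalSpace M] [CompactSpace M] (m : ℕ)
    (C : CartanCalc M) (hdim : C.dim = m)
    (A : CDGA) (hconn : A.Connected) (hd : A.d = 0)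
    (z : A.carrier) (hz : z ∈ A.grading 2) (l : ℕ)
    (hzl : z ^ l ≠ 0) (hzl1 : z ^ (l + 1) = 0)
    (E : CDGA) (hE : IsHirschExt1 A z E) (hq : QIso C.Ω E) :
    ∀ n : ℕ, m ≤ n → A.grading n = ⊥ := by
  intro n hn
  have hvC : Stmt7.Van m C.Ω := by
    intro k hk x hx
    have hx2 := hx.2
    rw [C.grading_top k (by omega)] at hx2
    have hx0 : x = 0 := hx2
    rw [hx0]
    exact Submodule.zero_mem _
  have hv : Stmt7.Van m E := (Stmt7.van_qiso hq).1 hvC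
  rw [eq_bot_iff]
  intro w hw
  have h0 : w = 0 := Stmt7.key_pow hd hz hE hv (l + 1) hn hw (by rw [hzl1, mul_zero])
  exact h0
end
end

section
/- Let (B,d) be a CDGA, D ∈ Der_{−1}(B) a derivation of degree −1 with [D,d] = 0 and D² = 0, and η ∈ B_1 an element with Dη = 1. Let B_D ⊂ B denote the kernel of D. Then the map f: (B_D ⊗ ∧⟨y⟩, dy = dη) → (B,d) defined by f(a ⊗ 1 + b ⊗ y) = a + bη is an isomorphism of CDGAs. -/
open scoped Manifold

noncomputable section

/-- Induction on the homogeneous decomposition of a CDGA. -/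
theorem CDGA.hom_induction (S : CDGA) {P : S.carrier → Prop}
    (h0 : P 0) (hadd : ∀ a b, P a → P b → P (a + b))
    (hh : ∀ n a, a ∈ S.grading n → P a) (a : S.carrier) : P a := by
  have ha : a ∈ ⨆ n, S.grading n := by
    rw [S.internal.submodule_iSup_eq_top]; trivial
  exact Submodule.iSup_induction S.grading (motive := P) ha hh h0 hadd

theorem CDGA.sq_zero (S : CDGA) {a : S.carrier} (ha : a ∈ S.grading 1) : a * a = 0 := by
  have h := S.gcomm ha ha
  simp only [mul_one, pow_one, neg_smul, one_smul] at h
  have h2 : (2 : ℝ) • (a * a) = 0 := by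
    rw [two_smul]; nth_rewrite 1 [h]; simp
  exact (smul_eq_zero.mp h2).resolve_left two_ne_zero

/-- The inverse of the canonical map. -/
theorem exists_inverse (B : CDGA) (D : DerNeg1 B)
    (hDsq : ∀ a, D.D (D.D a) = 0)
    (η : B.carrier) (hη : η ∈ B.grading 1) (hDη : D.D η = 1)
    (K : CDGA) (κ : CDGAHom K B) (hκinj : Function.Injective κ.toLin)
    (hκ : ∀ n, (K.grading n).map κ.toLin = B.grading n ⊓ LinearMap.ker D.D)
    (zK : K.carrier) (hzKval : κ.toLin zK = B.d η)
    (E : CDGA) (ι : CDGAHom K E) (y : E.carrier) (hy : y ∈ E.grading 1)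
    (hdy : E.d y = ι.toLin zK) :
    ∃ Ψ : CDGAHom B E, (∀ a b, Ψ.toLin (κ.toLin a + η * κ.toLin b) = ι.toLin a + y * ι.toLin b) ∧
      ∀ x, ∃ a b, x = κ.toLin a + η * κ.toLin b := by
  have hDη' : ∀ b, D.D (η * b) = b - η * D.D b := by
    intro b
    rw [D.antider hη, hDη]; simp [sub_eq_add_neg]
  have hDκ : ∀ a, D.D (κ.toLin a) = 0 := by
    intro a
    refine K.hom_induction (P := fun a => D.D (κ.toLin a) = 0) (by simp) ?_ ?_ a
    · intro a b ha hb; simp [ha, hb]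
    · intro n a ha
      have : κ.toLin a ∈ (K.grading n).map κ.toLin := Submodule.mem_map_of_mem ha
      rw [hκ] at this
      exact this.2
  let p : B.carrier →ₗ[ℝ] B.carrier := LinearMap.id - LinearMap.mulLeft ℝ η ∘ₗ D.D
  have hp : ∀ x, p x = x - η * D.D x := fun x => rfl
  have hDp : ∀ x, D.D (p x) = 0 := by
    intro x; rw [hp, map_sub, hDη', hDsq]; simp
  have hηD : ∀ n x, x ∈ B.grading n → η * D.D x ∈ B.grading n := by
    intro n x hx
    cases n with
    | zero => rw [D.zero hx]; simp
    | succ n => rw [add_comm]; exact B.mul_mem hη (D.mem hx)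
  have hpg : ∀ n x, x ∈ B.grading n → p x ∈ (K.grading n).map κ.toLin := by
    intro n x hx
    rw [hκ]
    exact ⟨Submodule.sub_mem _ hx (hηD n x hx), hDp x⟩
  have hpr : ∀ x, p x ∈ LinearMap.range κ.toLin := by
    intro x
    refine B.hom_induction (P := fun x => p x ∈ LinearMap.range κ.toLin) (by simp) ?_ ?_ x
    · intro a b ha hb; rw [map_add]; exact Submodule.add_mem _ ha hb
    · intro n a ha
      exact LinearMap.map_le_range (hpg n a ha)
  have hDr : ∀ x, D.D x ∈ LinearMap.range κ.toLin := by
    intro x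
    have := hpr (D.D x)
    rwa [hp, hDsq, mul_zero, sub_zero] at this
  let e := LinearEquiv.ofInjective κ.toLin hκinj
  let s : B.carrier →ₗ[ℝ] K.carrier := e.symm.toLinearMap ∘ₗ p.codRestrict _ hpr
  let t : B.carrier →ₗ[ℝ] K.carrier := e.symm.toLinearMap ∘ₗ D.D.codRestrict _ hDr
  have hs : ∀ x, κ.toLin (s x) = p x := by
    intro x
    have := congrArg Subtype.val (e.apply_symm_apply (p.codRestrict _ hpr x))
    exact this
  have ht : ∀ x, κ.toLin (t x) = D.D x := by
    intro x
    have := congrArg Subtype.val (e.apply_symm_apply (D.D.codRestrict _ hDr x))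
    exact this
  have hdec : ∀ x, x = κ.toLin (s x) + η * κ.toLin (t x) := by
    intro x; rw [hs, ht, hp]; simp
  have hDF : ∀ a b, D.D (κ.toLin a + η * κ.toLin b) = κ.toLin b := by
    intro a b; rw [map_add, hDη', hDκ, hDκ]; simp
  have ht' : ∀ a b, t (κ.toLin a + η * κ.toLin b) = b := by
    intro a b; apply hκinj; rw [ht, hDF]
  have hs' : ∀ a b, s (κ.toLin a + η * κ.toLin b) = a := by
    intro a b; apply hκinj; rw [hs, hp, hDF]; simp
  let Ψ : B.carrier →ₗ[ℝ] E.carrier :=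
    ι.toLin ∘ₗ s + LinearMap.mulLeft ℝ y ∘ₗ ι.toLin ∘ₗ t
  have hΨ0 : ∀ x, Ψ x = ι.toLin (s x) + y * ι.toLin (t x) := fun x => rfl
  have hΨ : ∀ a b, Ψ (κ.toLin a + η * κ.toLin b) = ι.toLin a + y * ι.toLin b := by
    intro a b; rw [hΨ0, hs', ht']
  have hΨκ : ∀ a, Ψ (κ.toLin a) = ι.toLin a := by
    intro a; simpa using hΨ a 0
  have hΨηκ : ∀ a, Ψ (η * κ.toLin a) = y * ι.toLin a := by
    intro a; simpa using hΨ 0 a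
  have hη2 := B.sq_zero hη
  have hy2 := E.sq_zero hy
  have hΨη : ∀ w, Ψ (η * w) = y * Ψ w := by
    intro w
    rw [hdec w, hΨ, mul_add, mul_add, ← mul_assoc, ← mul_assoc, hη2, hy2]
    simp [hΨηκ]
  have hκη : ∀ m a, a ∈ K.grading m → ∀ w, κ.toLin a * (η * w)
      = ((-1 : ℝ) ^ m) • (η * (κ.toLin a * w)) := by
    intro m a ha w
    rw [← mul_assoc, B.gcomm (κ.map_grading ha) hη, mul_one, smul_mul_assoc, mul_assoc]
  have hιy : ∀ m a, a ∈ K.grading m → ∀ w, ι.toLin a * (y * w)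
      = ((-1 : ℝ) ^ m) • (y * (ι.toLin a * w)) := by
    intro m a ha w
    rw [← mul_assoc, E.gcomm (ι.map_grading ha) hy, mul_one, smul_mul_assoc, mul_assoc]
  have hΨκmul : ∀ a w, Ψ (κ.toLin a * w) = ι.toLin a * Ψ w := by
    intro a w
    refine K.hom_induction (P := fun a => Ψ (κ.toLin a * w) = ι.toLin a * Ψ w)
      (by simp) ?_ ?_ a
    · intro a b ha hb; simp only [map_add, add_mul, ha, hb]
    · intro m a ha
      rw [hdec w, hΨ, mul_add, mul_add, hκη m a ha, hιy m a ha, ← κ.map_mul, ← κ.map_mul,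
        map_add, hΨκ, map_smul, hΨηκ, ι.map_mul, ι.map_mul]
  refine ⟨⟨Ψ, ?_, ?_, ?_, ?_⟩, hΨ, fun x => ⟨s x, t x, hdec x⟩⟩
  · rw [← κ.map_one, hΨκ, ι.map_one]
  · intro x w
    rw [hdec x, add_mul, map_add, mul_assoc, hΨη, hΨκmul, hΨκmul, hΨ, add_mul, mul_assoc]
  · intro n x hx
    rw [hΨ0]
    refine Submodule.add_mem _ (ι.map_grading ?_) ?_
    · obtain ⟨a, ha, hax⟩ := hpg n x hx
      rw [← hs] at hax
      rw [← hκinj hax]; exact ha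
    · cases n with
      | zero =>
        have : t x = 0 := by apply hκinj; rw [ht, D.zero hx, map_zero]
        rw [this]; simp
      | succ n =>
        rw [add_comm n 1]
        refine E.mul_mem hy (ι.map_grading ?_)
        have h1 : D.D x ∈ (K.grading n).map κ.toLin := by
          rw [hκ]; exact ⟨D.mem hx, hDsq x⟩
        obtain ⟨a, ha, hax⟩ := h1
        rw [← ht] at hax
        rw [← hκinj hax]; exact ha
  · intro x
    rw [hdec x, hΨ, map_add, map_add, map_add, B.leibniz hη, E.leibniz hy, hdy, ← hzKval,
      ← κ.map_d, ← κ.map_d, ← κ.map_mul, map_add, map_smul, hΨκ, hΨκ, hΨηκ, ι.map_d,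
      ι.map_mul, ι.map_d]

/-- for a CDGA `(B,d)`, a degree `-1` derivation `D` with `[D,d] = 0`,
`D² = 0`, and `η ∈ B₁` with `Dη = 1`, the canonical map
`(B_D ⊗ ∧⟨y⟩, dy = dη) → B`, `a ⊗ 1 + b ⊗ y ↦ a + bη`, is an isomorphism of CDGAs;
here `K` realizes the kernel sub-CDGA `B_D` and `Φ` is the canonical map. -/
theorem statement9 (B : CDGA) (D : DerNeg1 B)
    (hDd : ∀ a, D.D (B.d a) + B.d (D.D a) = 0)
    (hDsq : ∀ a, D.D (D.D a) = 0)
    (η : B.carrier) (hη : η ∈ B.grading 1) (hDη : D.D η = 1)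
    (K : CDGA) (κ : CDGAHom K B) (hκinj : Function.Injective κ.toLin)
    (hκ : ∀ n, (K.grading n).map κ.toLin = B.grading n ⊓ LinearMap.ker D.D)
    (zK : K.carrier) (hzK : zK ∈ K.grading 2) (hzKval : κ.toLin zK = B.d η)
    (E : CDGA) (hE : IsHirschExt1 K zK E)
    (Φ : CDGAHom E B) (hΦι : ∀ a, Φ.toLin (hE.incl.toLin a) = κ.toLin a)
    (hΦy : Φ.toLin hE.y = η) :
    Φ.IsIso := by
  obtain ⟨Ψ, hΨ, hdec⟩ := exists_inverse B D hDsq η hη hDη K κ hκinj hκ zK hzKval E hE.incl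
    hE.y hE.y_mem hE.dy
  have hr : ∀ x, Φ.toLin (Ψ.toLin x) = x := by
    intro x
    obtain ⟨a, b, rfl⟩ := hdec x
    rw [hΨ, map_add, Φ.map_mul, hΦι, hΦι, hΦy]
  let idE : CDGAHom E E := ⟨LinearMap.id, rfl, fun _ _ => rfl, fun h => h, fun _ => rfl⟩
  let co : CDGAHom E E := ⟨Ψ.toLin ∘ₗ Φ.toLin, by simp [Φ.map_one, Ψ.map_one],
    by intro a b; simp [Φ.map_mul, Ψ.map_mul],
    fun h => Ψ.map_grading (Φ.map_grading h), by intro a; simp [Φ.map_d, Ψ.map_d]⟩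
  have hco : co = idE := by
    refine (hE.universal E hE.incl hE.y hE.y_mem hE.dy).unique ⟨?_, ?_⟩
      ⟨fun _ => rfl, rfl⟩
    · intro a
      change Ψ.toLin (Φ.toLin (hE.incl.toLin a)) = _
      rw [hΦι]; simpa using hΨ a 0
    · change Ψ.toLin (Φ.toLin hE.y) = _
      rw [hΦy]; simpa [κ.map_one, hE.incl.map_one] using hΨ 0 1
  have hl : ∀ x, Ψ.toLin (Φ.toLin x) = x := fun x =>
    congrArg (fun F : CDGAHom E E => F.toLin x) hco
  refine ⟨⟨Function.LeftInverse.injective hl, Function.RightInverse.surjective hr⟩, fun n => ?_⟩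
  apply le_antisymm
  · rintro _ ⟨x, hx, rfl⟩
    exact Φ.map_grading hx
  · intro x hx
    exact ⟨Ψ.toLin x, Ψ.map_grading hx, hr x⟩
end
end

section
/- Let g be a finite-dimensional abelian Lie algebra, (B,d) a CDGA, and i: g → Der_{−1}(B) an operation with L_a = [i_a,d] = 0 for all a ∈ g, admitting an algebraic connection χ: g* → B_1. Let B_i denote the subalgebra of elements b ∈ B with i_a b = 0 for all a ∈ g, and let χ̄ = d∘χ: g* → B_2. Then the map f: (B_i ⊗ ∧g*, d_{χ̄}) → (B,d) given by f(b ⊗ α₁∧…∧α_k) = b·χ(α₁)⋯χ(α_k) is an isomorphism of CDGAs. -/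
open scoped Manifold

noncomputable section

namespace S10

theorem d_one (S : CDGA) : S.d 1 = 0 := by
  have h := S.leibniz S.one_mem 1
  simpa using h

theorem sq_zero (S : CDGA) {j : S.carrier} (hj : j ∈ S.grading 1) : j * j = 0 := by
  have h := S.gcomm hj hj
  have h2 : (2 : ℝ) • (j * j) = 0 := by
    rw [two_smul]
    nth_rewrite 1 [h]
    simp
  exact (smul_eq_zero.mp h2).resolve_left two_ne_zero

theorem hom_induction (S : CDGA) {p : S.carrier → Prop}
    (h : ∀ n, ∀ a ∈ S.grading n, p a) (h0 : p 0)
    (hadd : ∀ a b, p a → p b → p (a + b)) (a : S.carrier) : p a := by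
  have ha : a ∈ ⨆ n, S.grading n := by
    rw [S.internal.submodule_iSup_eq_top]; trivial
  exact Submodule.iSup_induction S.grading (motive := p) ha h h0 hadd

/-- Degree shift of a family of submodules. -/
def sh {M : Type} [AddCommGroup M] [Module ℝ M] (F : ℕ → Submodule ℝ M) :
    ℕ → Submodule ℝ M
  | 0 => ⊥
  | n + 1 => F n

/-- The family `F + j F`. -/
def ext {M : Type} [Ring M] [Algebra ℝ M] (F : ℕ → Submodule ℝ M) (j : M) (n : ℕ) :
    Submodule ℝ M :=
  F n ⊔ (sh F n).map (LinearMap.mulLeft ℝ j)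

theorem mem_ext {M : Type} [Ring M] [Algebra ℝ M] {F : ℕ → Submodule ℝ M} {j : M} {n : ℕ}
    {z : M} : z ∈ ext F j n ↔ ∃ x ∈ F n, ∃ y ∈ sh F n, x + j * y = z := by
  simp [ext, Submodule.mem_sup]

/-- A graded differential subalgebra. -/
structure Sub (E : CDGA) (F : ℕ → Submodule ℝ E.carrier) : Prop where
  le : ∀ n, F n ≤ E.grading n
  one : (1 : E.carrier) ∈ F 0
  mul : ∀ {m n a b}, a ∈ F m → b ∈ F n → a * b ∈ F (m + n)
  d : ∀ {n a}, a ∈ F n → E.d a ∈ F (n + 1)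

theorem Sub.extend {E : CDGA} {F : ℕ → Submodule ℝ E.carrier} (h : Sub E F)
    {j : E.carrier} (hj : j ∈ E.grading 1) (hd : E.d j ∈ F 2) : Sub E (ext F j) := by
  have shle : ∀ {n y}, y ∈ sh F n → j * y ∈ E.grading n := by
    intro n y hy
    cases n with
    | zero => simp only [sh, Submodule.mem_bot] at hy; simp [hy]
    | succ n => rw [add_comm]; exact E.mul_mem hj (h.le n hy)
  have shmul : ∀ {m n x y}, x ∈ sh F m → y ∈ F n → x * y ∈ sh F (m + n) := by
    intro m n x y hx hy
    cases m with
    | zero => simp only [sh, Submodule.mem_bot] at hx; simp [hx]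
    | succ m =>
      rw [show m + 1 + n = (m + n) + 1 by omega]
      exact h.mul hx hy
  have mulsh : ∀ {m n x y}, x ∈ F m → y ∈ sh F n → x * y ∈ sh F (m + n) := by
    intro m n x y hx hy
    cases n with
    | zero => simp only [sh, Submodule.mem_bot] at hy; simp [hy]
    | succ n => exact h.mul hx hy
  have comm : ∀ {m x}, x ∈ F m → x * j = ((-1 : ℝ) ^ m) • (j * x) := by
    intro m x hx
    simpa using E.gcomm (h.le m hx) hj
  have jyj : ∀ {m y}, y ∈ sh F m → j * y * j = 0 := by
    intro m y hy
    cases m with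
    | zero => simp only [sh, Submodule.mem_bot] at hy; simp [hy]
    | succ m =>
      rw [mul_assoc, comm hy, mul_smul_comm, ← mul_assoc, sq_zero E hj]; simp
  refine ⟨?_, ?_, ?_, ?_⟩
  · intro n z hz
    obtain ⟨x, hx, y, hy, rfl⟩ := mem_ext.mp hz
    exact add_mem (h.le n hx) (shle hy)
  · exact mem_ext.mpr ⟨1, h.one, 0, zero_mem _, by simp⟩
  · intro m n a b ha hb
    obtain ⟨x, hx, y, hy, rfl⟩ := mem_ext.mp ha
    obtain ⟨x', hx', y', hy', rfl⟩ := mem_ext.mp hb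
    refine mem_ext.mpr ⟨x * x', h.mul hx hx', ((-1 : ℝ) ^ m) • (x * y') + y * x',
      add_mem (Submodule.smul_mem _ _ (mulsh hx hy')) (shmul hy hx'), ?_⟩
    have e1 : x * (j * y') = j * (((-1 : ℝ) ^ m) • (x * y')) := by
      rw [← mul_assoc, comm hx, smul_mul_assoc, mul_smul_comm, mul_assoc]
    have e2 : j * y * (j * y') = 0 := by rw [← mul_assoc, jyj hy, zero_mul]
    rw [mul_add (x + j * y), add_mul, add_mul, e1, e2, mul_add, mul_assoc j y x']
    abel
  · intro n a ha
    obtain ⟨x, hx, y, hy, rfl⟩ := mem_ext.mp ha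
    have dy : E.d y ∈ sh F (n + 1) := by
      cases n with
      | zero => simp only [sh, Submodule.mem_bot] at hy; simp [hy]
      | succ n => exact h.d hy
    have djy : E.d j * y ∈ F (n + 1) := by
      cases n with
      | zero => simp only [sh, Submodule.mem_bot] at hy; simp [hy]
      | succ n => rw [show n + 1 + 1 = 2 + n by omega]; exact h.mul hd hy
    refine mem_ext.mpr ⟨E.d x + E.d j * y, add_mem (h.d hx) djy, - E.d y, neg_mem dy, ?_⟩
    rw [map_add, E.leibniz hj]
    simp
    abel

variable {L : Type} [LieRing L] [LieAlgebra ℝ L]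

theorem i_anti {B : CDGA} (op : Operation L B) (x y : L) (b : B.carrier) :
    op.i x (op.i y b) = - op.i y (op.i x b) := by
  have h := op.i_sq (x + y) b
  simp only [map_add, LinearMap.add_apply, op.i_sq] at h
  rw [eq_neg_iff_add_eq_zero]
  simpa [add_comm] using h

theorem i_chi {B : CDGA} {op : Operation L B} (χ : AlgConnection op) (x : L)
    (α : Module.Dual ℝ L) (b : B.carrier) :
    op.i x (χ.χ α * b) = α x • b - χ.χ α * op.i x b := by
  rw [op.i_antider x (χ.mem α), χ.horizontal]
  simp [sub_eq_add_neg]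

/-- Subalgebra mapped bijectively to the elements killed by `i (v l)`, `l ∉ s`. -/
structure Good {ι : Type} {B E : CDGA} (op : Operation L B) (v : ι → L)
    (Φ : CDGAHom E B) (s : Finset ι) (F : ℕ → Submodule ℝ E.carrier) : Prop where
  sub : Sub E F
  kill : ∀ {n x}, x ∈ F n → ∀ l ∉ s, op.i (v l) (Φ.toLin x) = 0
  inj : ∀ {n x}, x ∈ F n → Φ.toLin x = 0 → x = 0
  surj : ∀ {n b}, b ∈ B.grading n → (∀ l ∉ s, op.i (v l) b = 0) → ∃ x ∈ F n, Φ.toLin x = b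

theorem Good.step {ι : Type} [DecidableEq ι] {B E : CDGA} {op : Operation L B}
    (χ : AlgConnection op) {v : ι → L} {w : ι → Module.Dual ℝ L}
    (hvw : ∀ k l, w k (v l) = if k = l then 1 else 0)
    {Φ : CDGAHom E B} {s : Finset ι} {F : ℕ → Submodule ℝ E.carrier}
    (h : Good op v Φ s F) {k : ι} (hk : k ∉ s) {j : E.carrier} (hj : j ∈ E.grading 1)
    (hd : E.d j ∈ F 2) (hΦ : Φ.toLin j = χ.χ (w k)) :
    Good op v Φ (insert k s) (ext F j) := by
  have shkill : ∀ {n y}, y ∈ sh F n → ∀ l ∉ s, op.i (v l) (Φ.toLin y) = 0 := by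
    intro n y hy
    cases n with
    | zero => simp only [sh, Submodule.mem_bot] at hy; simp [hy]
    | succ n => exact h.kill hy
  have shinj : ∀ {n y}, y ∈ sh F n → Φ.toLin y = 0 → y = 0 := by
    intro n y hy
    cases n with
    | zero => simp only [sh, Submodule.mem_bot] at hy; simp [hy]
    | succ n => exact h.inj hy
  refine ⟨h.sub.extend hj hd, ?_, ?_, ?_⟩
  · intro n z hz l hl
    obtain ⟨x, hx, y, hy, rfl⟩ := mem_ext.mp hz
    simp only [Finset.mem_insert, not_or] at hl
    rw [map_add, Φ.map_mul, hΦ, map_add, i_chi, h.kill hx l hl.2, shkill hy l hl.2, hvw,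
      if_neg (Ne.symm hl.1)]
    simp
  · intro n z hz h0
    obtain ⟨x, hx, y, hy, rfl⟩ := mem_ext.mp hz
    rw [map_add, Φ.map_mul, hΦ] at h0
    have h1 := congrArg (op.i (v k)) h0
    rw [map_add, i_chi, h.kill hx k hk, shkill hy k hk, hvw] at h1
    have hy0 : y = 0 := shinj hy (by simpa using h1)
    subst hy0
    have hx0 : x = 0 := h.inj hx (by simpa using h0)
    simp [hx0]
  · intro n b hb hkill
    have hc : ∀ l ∉ s, op.i (v l) (op.i (v k) b) = 0 := by
      intro l hl
      by_cases e : l = k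
      · subst e; exact op.i_sq _ _
      · rw [i_anti, hkill l (by simp [e, hl])]; simp
    have hb' : ∀ l ∉ s, op.i (v l) (b - χ.χ (w k) * op.i (v k) b) = 0 := by
      intro l hl
      rw [map_sub, i_chi, hc l hl, hvw]
      by_cases e : l = k
      · subst e; simp
      · rw [hkill l (by simp [e, hl]), if_neg (Ne.symm e)]; simp
    have hy : ∃ y ∈ sh F n, Φ.toLin y = op.i (v k) b := by
      cases n with
      | zero => exact ⟨0, zero_mem _, by rw [op.i_zero _ hb, map_zero]⟩
      | succ n => exact h.surj (op.i_mem _ hb) hc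
    obtain ⟨y, hy, ey⟩ := hy
    have hdeg : χ.χ (w k) * op.i (v k) b ∈ B.grading n := by
      cases n with
      | zero => rw [op.i_zero _ hb, mul_zero]; exact zero_mem _
      | succ n => rw [add_comm]; exact B.mul_mem (χ.mem _) (op.i_mem _ hb)
    obtain ⟨x, hx, ex⟩ := h.surj (sub_mem hb hdeg) hb'
    refine ⟨x + j * y, mem_ext.mpr ⟨x, hx, y, hy, rfl⟩, ?_⟩
    rw [map_add, Φ.map_mul, hΦ, ex, ey]
    abel

/-- A morphism bijective on a graded differential subalgebra has a section. -/
theorem exists_section {E B : CDGA} (Φ : CDGAHom E B) (F : ℕ → Submodule ℝ E.carrier)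
    (hF : Sub E F) (inj : ∀ n, ∀ x ∈ F n, Φ.toLin x = 0 → x = 0)
    (surj : ∀ n, ∀ b ∈ B.grading n, ∃ x ∈ F n, Φ.toLin x = b) :
    ∃ Ψ : CDGAHom B E, ∀ n, ∀ x ∈ F n, Ψ.toLin (Φ.toLin x) = x := by
  let f : ∀ n, F n →ₗ[ℝ] B.grading n := fun n =>
    Φ.toLin.restrict (p := F n) (q := B.grading n) (fun x hx => Φ.map_grading (hF.le n hx))
  have hf : ∀ n, Function.Bijective (f n) := by
    intro n
    constructor
    · rw [← LinearMap.ker_eq_bot, LinearMap.ker_eq_bot']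
      intro x hx
      exact Subtype.ext (inj n x x.2 (congrArg Subtype.val hx))
    · rintro ⟨b, hb⟩
      obtain ⟨x, hx, e⟩ := surj n b hb
      exact ⟨⟨x, hx⟩, Subtype.ext e⟩
  let e : ∀ n, F n ≃ₗ[ℝ] B.grading n := fun n => LinearEquiv.ofBijective (f n) (hf n)
  let D := LinearEquiv.ofBijective (DirectSum.coeLinearMap B.grading) B.internal
  let Ψ : B.carrier →ₗ[ℝ] E.carrier :=
    (DirectSum.toModule ℝ ℕ E.carrier
      (fun n => (F n).subtype ∘ₗ (e n).symm.toLinearMap)) ∘ₗ D.symm.toLinearMap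
  have key : ∀ n, ∀ x ∈ F n, Ψ (Φ.toLin x) = x := by
    intro n x hx
    have h1 : D.symm (Φ.toLin x) = DirectSum.lof ℝ ℕ (fun n => B.grading n) n (e n ⟨x, hx⟩) := by
      rw [LinearEquiv.symm_apply_eq]
      change _ = DirectSum.coeLinearMap B.grading _
      rw [DirectSum.coeLinearMap_lof]
      rfl
    change DirectSum.toModule ℝ ℕ E.carrier _ (D.symm (Φ.toLin x)) = x
    rw [h1, DirectSum.toModule_lof]
    simp
  refine ⟨⟨Ψ, ?_, ?_, ?_, ?_⟩, key⟩
  · have := key 0 1 hF.one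
    rwa [Φ.map_one] at this
  · intro a b
    refine hom_induction B (p := fun a => Ψ (a * b) = Ψ a * Ψ b) ?_ (by simp) ?_ a
    · intro m a ha
      refine hom_induction B (p := fun b => Ψ (a * b) = Ψ a * Ψ b) ?_ (by simp) ?_ b
      · intro n b hb
        obtain ⟨x, hx, rfl⟩ := surj m a ha
        obtain ⟨y, hy, rfl⟩ := surj n b hb
        rw [← Φ.map_mul, key _ _ hx, key _ _ hy, key _ _ (hF.mul hx hy)]
      · intro b c hb hc
        rw [mul_add, map_add, hb, hc, map_add, mul_add]
    · intro a c ha hc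
      rw [add_mul, map_add, ha, hc, map_add, add_mul]
  · intro n b hb
    obtain ⟨x, hx, rfl⟩ := surj n b hb
    rw [key _ _ hx]
    exact hF.le n hx
  · intro a
    refine hom_induction B (p := fun a => Ψ (B.d a) = E.d (Ψ a)) ?_ (by simp) ?_ a
    · intro n b hb
      obtain ⟨x, hx, rfl⟩ := surj n b hb
      rw [← Φ.map_d, key _ _ hx, key _ _ (hF.d hx)]
    · intro a b ha hb
      rw [map_add, map_add, ha, hb, map_add, map_add]

end S10

/-- for an operation of a finite-dimensional abelian Lie algebra `g`
in a CDGA `B` with all Lie derivatives zero, admitting an algebraic connection `χ`,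
the canonical map `(B_i ⊗ ∧g*, d_χ̄) → B`,
`b ⊗ α₁ ∧ … ∧ α_k ↦ b·χ(α₁)⋯χ(α_k)`, is an isomorphism of CDGAs; here `K` realizes
the sub-CDGA `B_i` and `Φ` is the canonical map. -/
theorem statement10 {L : Type} [LieRing L] [LieAlgebra ℝ L] [Module.Finite ℝ L]
    (habl : ∀ x y : L, ⁅x, y⁆ = 0)
    (B : CDGA) (op : Operation L B)
    (hLzero : ∀ (x : L) (a : B.carrier), op.i x (B.d a) + B.d (op.i x a) = 0)
    (χ : AlgConnection op)
    (K : CDGA) (κ : CDGAHom K B) (hκinj : Function.Injective κ.toLin)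
    (hκ : ∀ n, (K.grading n).map κ.toLin = B.grading n ⊓ op.iKer)
    (fK : Module.Dual ℝ L →ₗ[ℝ] K.carrier)
    (hfK : ∀ α, κ.toLin (fK α) = B.d (χ.χ α))
    (E : CDGA) (hE : IsHirschExtDeg1 K (Module.Dual ℝ L) fK E)
    (Φ : CDGAHom E B) (hΦι : ∀ a, Φ.toLin (hE.incl.toLin a) = κ.toLin a)
    (hΦj : ∀ α, Φ.toLin (hE.j α) = χ.χ α) :
    Φ.IsIso := by
  classical
  let b := Module.finBasis ℝ L
  let w : Fin (Module.finrank ℝ L) → Module.Dual ℝ L := fun k => b.coord k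
  have hvw : ∀ k l, w k (b l) = if k = l then 1 else 0 := by
    intro k l
    simp [w, Finsupp.single_apply, eq_comm]
  have hker : ∀ x, x ∈ op.iKer ↔ ∀ l, op.i (b l) x = 0 := by
    intro x
    simp only [Operation.iKer, Submodule.mem_iInf, LinearMap.mem_ker]
    refine ⟨fun h l => h _, fun h y => ?_⟩
    have h2 : op.i.flip x = 0 := b.ext (fun l => by simpa using h l)
    simpa using congrArg (fun f => f y) h2
  have hfK2 : ∀ α, fK α ∈ K.grading 2 := by
    intro α
    have hm : B.d (χ.χ α) ∈ (K.grading 2).map κ.toLin := by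
      rw [hκ]
      refine ⟨B.d_mem (χ.mem α), (hker _).mpr fun l => ?_⟩
      have h := hLzero (b l) (χ.χ α)
      rw [χ.horizontal, map_smul, S10.d_one] at h
      simpa using h
    obtain ⟨k, hk, e⟩ := hm
    rw [← hfK] at e
    rw [← hκinj e]
    exact hk
  have main : ∀ s : Finset (Fin (Module.finrank ℝ L)), ∃ F : ℕ → Submodule ℝ E.carrier,
      S10.Good op b Φ s F ∧ (∀ n, (K.grading n).map hE.incl.toLin ≤ F n) ∧
      ∀ k ∈ s, hE.j (w k) ∈ F 1 := by
    intro s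
    induction s using Finset.induction_on with
    | empty =>
      refine ⟨fun n => (K.grading n).map hE.incl.toLin, ⟨⟨?_, ?_, ?_, ?_⟩, ?_, ?_, ?_⟩,
        fun n => le_rfl, by simp⟩
      · rintro n _ ⟨k, hk, rfl⟩
        exact hE.incl.map_grading hk
      · exact ⟨1, K.one_mem, hE.incl.map_one⟩
      · rintro m n _ _ ⟨k, hk, rfl⟩ ⟨k', hk', rfl⟩
        exact ⟨k * k', K.mul_mem hk hk', hE.incl.map_mul _ _⟩
      · rintro n _ ⟨k, hk, rfl⟩
        exact ⟨K.d k, K.d_mem hk, hE.incl.map_d _⟩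
      · rintro n _ ⟨k, hk, rfl⟩ l -
        rw [hΦι]
        have hm : κ.toLin k ∈ (K.grading n).map κ.toLin := ⟨k, hk, rfl⟩
        rw [hκ] at hm
        exact (hker _).mp hm.2 l
      · rintro n _ ⟨k, hk, rfl⟩ h0
        rw [hΦι] at h0
        have : k = 0 := hκinj (by rw [h0, map_zero])
        rw [this, map_zero]
      · intro n c hc hkill
        have hm : c ∈ (K.grading n).map κ.toLin := by
          rw [hκ]
          exact ⟨hc, (hker _).mpr fun l => hkill l (by simp)⟩
        obtain ⟨k, hk, e⟩ := hm
        exact ⟨_, ⟨k, hk, rfl⟩, by rw [hΦι, e]⟩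
    | insert k s hk ih =>
      obtain ⟨F, hF, hKF, hjF⟩ := ih
      have hd : E.d (hE.j (w k)) ∈ F 2 := by
        rw [hE.dj]
        exact hKF 2 ⟨_, hfK2 _, rfl⟩
      have hle : ∀ n, F n ≤ S10.ext F (hE.j (w k)) n := fun n => le_sup_left
      refine ⟨S10.ext F (hE.j (w k)),
        hF.step χ hvw hk (hE.j_mem _) hd (hΦj _), fun n => (hKF n).trans (hle n), ?_⟩
      intro l hl
      rcases Finset.mem_insert.mp hl with rfl | hl
      · exact S10.mem_ext.mpr ⟨0, zero_mem _, 1, hF.sub.one, by simp⟩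
      · exact hle 1 (hjF l hl)
  obtain ⟨F, hF, hKF, hjF⟩ := main Finset.univ
  have hsurj : ∀ n, ∀ c ∈ B.grading n, ∃ x ∈ F n, Φ.toLin x = c :=
    fun n c hc => hF.surj hc (by simp)
  obtain ⟨Ψ, hΨ⟩ := S10.exists_section Φ F hF.sub (fun n x hx => hF.inj hx) hsurj
  have hjall : ∀ α, hE.j α ∈ F 1 := by
    intro α
    have : α = ∑ k, α (b k) • w k := by
      refine b.ext fun l => ?_
      simp [hvw]
    rw [this, map_sum]
    refine Submodule.sum_mem _ fun k _ => ?_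
    rw [map_smul]
    exact Submodule.smul_mem _ _ (hjF k (Finset.mem_univ _))
  let comp : CDGAHom E E := ⟨Ψ.toLin ∘ₗ Φ.toLin, by simp [Φ.map_one, Ψ.map_one],
    by simp [Φ.map_mul, Ψ.map_mul], fun h => Ψ.map_grading (Φ.map_grading h),
    by simp [Φ.map_d, Ψ.map_d]⟩
  let idE : CDGAHom E E := ⟨LinearMap.id, rfl, fun _ _ => rfl, fun h => h, fun _ => rfl⟩
  have hcomp : comp = idE := by
    refine (hE.universal E hE.incl hE.j hE.j_mem hE.dj).unique ⟨?_, ?_⟩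
      ⟨fun _ => rfl, fun _ => rfl⟩
    · intro a
      refine S10.hom_induction K
        (p := fun a => comp.toLin (hE.incl.toLin a) = hE.incl.toLin a) ?_ (by simp) ?_ a
      · intro n a ha
        exact hΨ n _ (hKF n ⟨a, ha, rfl⟩)
      · intro x y hx hy
        rw [map_add, map_add, hx, hy]
    · intro α
      exact hΨ 1 _ (hjall α)
  have hleft : ∀ x, Ψ.toLin (Φ.toLin x) = x := fun x =>
    congrArg (fun f : CDGAHom E E => f.toLin x) hcomp
  refine ⟨⟨Function.LeftInverse.injective hleft, ?_⟩, ?_⟩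
  · intro c
    refine S10.hom_induction B (p := fun c => ∃ x, Φ.toLin x = c) ?_ ⟨0, map_zero _⟩ ?_ c
    · intro n c hc
      obtain ⟨x, -, e⟩ := hsurj n c hc
      exact ⟨x, e⟩
    · rintro _ _ ⟨x, rfl⟩ ⟨y, rfl⟩
      exact ⟨x + y, map_add _ _ _⟩
  · intro n
    apply le_antisymm
    · rintro _ ⟨x, hx, rfl⟩
      exact Φ.map_grading hx
    · intro c hc
      obtain ⟨x, hx, e⟩ := hsurj n c hc
      exact ⟨x, hF.sub.le n hx, e⟩
end
end

section
/- Let g be a finite-dimensional abelian Lie algebra, (A,d) a CDGA, and i: g → Der_{−1}(A) an operation admitting an algebraic connection χ: g* → A_1. Let A_L be the subalgebra of elements a with L_x a = 0 for all x ∈ g, A_{i,L} the subalgebra of elements with L_x a = i_x a = 0 for all x ∈ g, and χ̄ = d∘χ: g* → A_{i,L} (which indeed lands in A_{i,L}). Then the map f: (A_{i,L} ⊗ ∧g*, d_{χ̄}) → (A_L, d) given by f(a ⊗ α₁∧…∧α_k) = a·χ(α₁)⋯χ(α_k) is an isomorphism of CDGAs. -/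
open scoped Manifold

noncomputable section

/-! ## Helper lemmas for the proof -/

structure GoodMap (A E : CDGA) (B : Submodule ℝ A.carrier)
    (ψ : A.carrier →ₗ[ℝ] E.carrier) (θ : E.carrier →ₗ[ℝ] A.carrier) : Prop where
  mul : ∀ (m : ℕ) (a b : A.carrier), a ∈ A.grading m → a ∈ B → b ∈ B → ψ (a * b) = ψ a * ψ b
  gr : ∀ (m : ℕ) (a : A.carrier), a ∈ A.grading m → a ∈ B → ψ a ∈ E.grading m
  d : ∀ a ∈ B, ψ (A.d a) = E.d (ψ a)
  inv : ∀ a ∈ B, θ (ψ a) = a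

theorem CDGA.sq_zero_of_deg_one (S : CDGA) {y : S.carrier} (hy : y ∈ S.grading 1) :
    y * y = 0 := by
  have h := S.gcomm hy hy
  simp only [mul_one, pow_one, neg_smul, one_smul] at h
  have h2 : (2 : ℝ) • (y * y) = 0 := by
    rw [two_smul]; nth_rewrite 1 [h]; simp
  simpa using h2

theorem CDGA.sandwich_zero (S : CDGA) {y b : S.carrier} (hy : y ∈ S.grading 1) {k : ℕ}
    (hb : b ∈ S.grading k) (z : S.carrier) : y * b * (y * z) = 0 := by
  have h := S.gcomm hb hy
  have h2 : y * b * (y * z) = y * (b * y) * z := by noncomm_ring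
  rw [h2, h, mul_smul_comm, ← mul_assoc, S.sq_zero_of_deg_one hy]
  simp

theorem CDGA.induct (S : CDGA) {P : S.carrier → Prop}
    (hmem : ∀ n, ∀ a ∈ S.grading n, P a) (hadd : ∀ a b, P a → P b → P (a + b)) (x : S.carrier) :
    P x := by
  have hx : x ∈ ⨆ n, S.grading n := by
    rw [S.internal.submodule_iSup_eq_top]; trivial
  refine Submodule.iSup_induction S.grading (motive := P) hx hmem ?_ hadd
  exact hmem 0 0 (Submodule.zero_mem _)

def stepMap {A E : CDGA} (i : A.carrier →ₗ[ℝ] A.carrier) (y : A.carrier) (c : E.carrier)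
    (ψ : A.carrier →ₗ[ℝ] E.carrier) : A.carrier →ₗ[ℝ] E.carrier :=
  ψ ∘ₗ (LinearMap.id - LinearMap.mulLeft ℝ y ∘ₗ i) + LinearMap.mulLeft ℝ c ∘ₗ ψ ∘ₗ i

theorem stepMap_apply {A E : CDGA} (i : A.carrier →ₗ[ℝ] A.carrier) (y : A.carrier) (c : E.carrier)
    (ψ : A.carrier →ₗ[ℝ] E.carrier) (x : A.carrier) :
    stepMap i y c ψ x = ψ (x - y * i x) + c * ψ (i x) := by
  simp [stepMap]

theorem goodMap_step {A E : CDGA} {B B' : Submodule ℝ A.carrier}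
    {ψ : A.carrier →ₗ[ℝ] E.carrier} {θ : E.carrier →ₗ[ℝ] A.carrier}
    (h : GoodMap A E B ψ θ)
    (i : A.carrier →ₗ[ℝ] A.carrier) (y : A.carrier) (c : E.carrier)
    (hBmul : ∀ (m : ℕ) (a b : A.carrier), a ∈ A.grading m → a ∈ B → b ∈ B → a * b ∈ B)
    (hBd : ∀ a ∈ B, A.d a ∈ B)
    (hi0 : ∀ a ∈ B, i a = 0)
    (hdec : ∀ x ∈ B', i x ∈ B ∧ x - y * i x ∈ B)
    (i_mem : ∀ {n : ℕ} {a : A.carrier}, a ∈ A.grading (n + 1) → i a ∈ A.grading n)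
    (i_zero : ∀ {a : A.carrier}, a ∈ A.grading 0 → i a = 0)
    (i_antider : ∀ {m : ℕ} {a : A.carrier}, a ∈ A.grading m → ∀ b,
      i (a * b) = i a * b + ((-1 : ℝ) ^ m) • (a * i b))
    (hy : y ∈ A.grading 1) (hiy : i y = 1) (hdy : A.d y ∈ B)
    (hc : c ∈ E.grading 1) (hdc : E.d c = ψ (A.d y))
    (hθc : θ c = y) (hθmul : ∀ a b, θ (a * b) = θ a * θ b) :
    GoodMap A E B' (stepMap i y c ψ) θ := by
  have key : ∀ a ∈ B, ∀ b ∈ B, stepMap i y c ψ (a + y * b) = ψ a + c * ψ b := by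
    intro a ha b hb
    have : i (a + y * b) = b := by
      rw [map_add, hi0 a ha, i_antider hy, hiy, hi0 b hb]; simp
    rw [stepMap_apply, this]; simp
  have dec : ∀ x ∈ B', ∃ a ∈ B, ∃ b ∈ B, x = a + y * b ∧ i x = b ∧ a = x - y * b := by
    intro x hx
    exact ⟨_, (hdec x hx).2, _, (hdec x hx).1, by simp, rfl, rfl⟩
  have dech : ∀ (m : ℕ) (x : A.carrier), x ∈ A.grading m → x ∈ B' →
      ∃ a ∈ B, a ∈ A.grading m ∧ ∃ b ∈ B, x = a + y * b ∧
        (b = 0 ∨ ∃ k, m = k + 1 ∧ b ∈ A.grading k) := by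
    intro m x hxm hx
    obtain ⟨a, ha, b, hb, h1, h2, h3⟩ := dec x hx
    cases m with
    | zero =>
      have : b = 0 := by rw [← h2]; exact i_zero hxm
      refine ⟨a, ha, ?_, b, hb, h1, Or.inl this⟩
      rw [h3, this]; simpa using hxm
    | succ k =>
      have hbk : b ∈ A.grading k := by rw [← h2]; exact i_mem hxm
      refine ⟨a, ha, ?_, b, hb, h1, Or.inr ⟨k, rfl, hbk⟩⟩
      rw [h3]
      refine Submodule.sub_mem _ hxm ?_
      have := A.mul_mem hy hbk
      rwa [add_comm] at this
  refine ⟨?_, ?_, ?_, ?_⟩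
  · intro m x x' hxm hx hx'
    obtain ⟨a, ha, ham, b, hb, rfl, hbk⟩ := dech m x hxm hx
    obtain ⟨a', ha', b', hb', rfl, -, -⟩ := dec x' hx'
    have hbb : y * b * (y * b') = 0 := by
      rcases hbk with rfl | ⟨k, -, hbk⟩
      · simp
      · exact A.sandwich_zero hy hbk b'
    have hbb2 : c * ψ b * (c * ψ b') = 0 := by
      rcases hbk with rfl | ⟨k, -, hbk⟩
      · simp
      · exact E.sandwich_zero hc (h.gr k b hbk hb) (ψ b')
    have hba : ψ (b * a') = ψ b * ψ a' ∧ b * a' ∈ B := by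
      rcases hbk with rfl | ⟨k, -, hbk⟩
      · simp
      · exact ⟨h.mul k b a' hbk hb ha', hBmul k b a' hbk hb ha'⟩
    have hay : a * y = ((-1 : ℝ) ^ m) • (y * a) := by simpa using A.gcomm ham hy
    have hay2 : ψ a * c = ((-1 : ℝ) ^ m) • (c * ψ a) := by
      simpa using E.gcomm (h.gr m a ham ha) hc
    have e1 : (a + y * b) * (a' + y * b') =
        a * a' + y * (b * a' + ((-1 : ℝ) ^ m) • (a * b')) := by
      have : (a + y * b) * (a' + y * b') =
        a * a' + y * (b * a') + (a * y) * b' + y * b * (y * b') := by noncomm_ring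
      rw [this, hbb, hay, mul_add, mul_smul_comm, smul_mul_assoc, mul_assoc y a b', add_zero,
        add_assoc]
    have e2 : (ψ a + c * ψ b) * (ψ a' + c * ψ b') =
        ψ a * ψ a' + c * (ψ b * ψ a' + ((-1 : ℝ) ^ m) • (ψ a * ψ b')) := by
      have : (ψ a + c * ψ b) * (ψ a' + c * ψ b') =
        ψ a * ψ a' + c * (ψ b * ψ a') + (ψ a * c) * ψ b' + c * ψ b * (c * ψ b') := by
        noncomm_ring
      rw [this, hbb2, hay2, mul_add, mul_smul_comm, smul_mul_assoc, mul_assoc c, add_zero,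
        add_assoc]
    rw [e1, key a ha b hb, key a' ha' b' hb', e2,
      key _ (hBmul m a a' ham ha ha') _
        (B.add_mem hba.2 (B.smul_mem _ (hBmul m a b' ham ha hb'))),
      h.mul m a a' ham ha ha', map_add, map_smul, hba.1, h.mul m a b' ham ha hb']
  · intro m x hxm hx
    obtain ⟨a, ha, ham, b, hb, rfl, hbk⟩ := dech m x hxm hx
    rw [key a ha b hb]
    refine Submodule.add_mem _ (h.gr m a ham ha) ?_
    rcases hbk with rfl | ⟨k, rfl, hbk⟩
    · simp
    · have := E.mul_mem hc (h.gr k b hbk hb)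
      rwa [add_comm] at this
  · intro x hx
    obtain ⟨a, ha, b, hb, rfl, -, -⟩ := dec x hx
    have hdy2 := A.d_mem hy
    have e1 : A.d (a + y * b) = (A.d a + A.d y * b) + y * (-(A.d b)) := by
      rw [map_add, A.leibniz hy]; simp [add_assoc]
    rw [e1, key _ (B.add_mem (hBd a ha) (hBmul _ _ _ hdy2 hdy hb)) _ (B.neg_mem (hBd b hb)),
      key a ha b hb, map_add, map_add, E.leibniz hc, h.d a ha, h.mul _ _ _ hdy2 hdy hb, map_neg,
      h.d b hb, hdc]
    simp [add_assoc]
  · intro x hx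
    obtain ⟨a, ha, b, hb, rfl, -, -⟩ := dec x hx
    rw [key a ha b hb, map_add, hθmul, hθc, h.inv a ha, h.inv b hb]

/-- The projections onto the homogeneous components. -/
theorem CDGA.exists_proj (S : CDGA) : ∃ p : ℕ → S.carrier →ₗ[ℝ] S.carrier,
    (∀ n x, p n x ∈ S.grading n) ∧ (∀ n, ∀ x ∈ S.grading n, p n x = x) ∧
    (∀ m n, ∀ x ∈ S.grading m, m ≠ n → p n x = 0) ∧
    (∀ (P : Submodule ℝ S.carrier) x, (∀ n, p n x ∈ P) → x ∈ P) := by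
  classical
  let _ := S.internal.chooseDecomposition
  refine ⟨fun n => (S.grading n).subtype ∘ₗ DirectSum.component ℝ ℕ (fun n => S.grading n) n ∘ₗ
    (DirectSum.decomposeLinearEquiv S.grading).toLinearMap, ?_, ?_, ?_, ?_⟩
  · intro n x
    exact Subtype.property _
  · intro n x hx
    exact DirectSum.decompose_of_mem_same S.grading hx
  · intro m n x hx hmn
    exact DirectSum.decompose_of_mem_ne S.grading hx hmn
  · intro P x hx
    rw [← DirectSum.sum_support_decompose S.grading x]
    exact Submodule.sum_mem _ fun n _ => hx n

namespace Operation

variable {L : Type} [LieRing L] [LieAlgebra ℝ L] {S : CDGA}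

theorem mem_lieKer (op : Operation L S) {a : S.carrier} :
    a ∈ op.lieKer ↔ ∀ x, S.d (op.i x a) + op.i x (S.d a) = 0 := by
  simp [lieKer, lieD]

theorem mem_iKer (op : Operation L S) {a : S.carrier} :
    a ∈ op.iKer ↔ ∀ x, op.i x a = 0 := by
  simp [iKer]

theorem i_anticomm (op : Operation L S) (x y : L) (a : S.carrier) :
    op.i x (op.i y a) = - op.i y (op.i x a) := by
  have h := op.i_sq (x + y) a
  simp only [map_add, LinearMap.add_apply, op.i_sq, zero_add, add_zero] at h
  exact eq_neg_of_add_eq_zero_right h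

theorem lie_mul (op : Operation L S) (x : L) {m : ℕ} {a : S.carrier} (ha : a ∈ S.grading m)
    (b : S.carrier) :
    S.d (op.i x (a * b)) + op.i x (S.d (a * b)) =
      (S.d (op.i x a) + op.i x (S.d a)) * b + a * (S.d (op.i x b) + op.i x (S.d b)) := by
  rw [op.i_antider x ha, S.leibniz ha, map_add, map_add, map_smul, map_smul,
    op.i_antider x (S.d_mem ha), S.leibniz ha, op.i_antider x ha]
  cases m with
  | zero =>
    rw [op.i_zero x ha]
    simp
    noncomm_ring
  | succ k =>
    rw [S.leibniz (op.i_mem x ha)]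
    simp only [smul_add, smul_smul, pow_succ, mul_add, add_mul]
    simp only [mul_neg, mul_one, neg_smul, one_smul, neg_mul, neg_neg, ← mul_pow, one_pow]
    abel

theorem lieKer_mul (op : Operation L S) {m : ℕ} {a b : S.carrier} (ham : a ∈ S.grading m)
    (ha : a ∈ op.lieKer) (hb : b ∈ op.lieKer) : a * b ∈ op.lieKer := by
  rw [mem_lieKer] at *
  intro x
  rw [op.lie_mul x ham, ha, hb]; simp

theorem lieKer_d (op : Operation L S) {a : S.carrier}
    (ha : a ∈ op.lieKer) : S.d a ∈ op.lieKer := by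
  rw [mem_lieKer] at *
  intro x
  have : op.i x (S.d a) = - S.d (op.i x a) := eq_neg_of_add_eq_zero_right (ha x)
  rw [this, S.d_d]; simp [S.d_d]

theorem lieKer_i (op : Operation L S) (habl : ∀ x y : L, ⁅x, y⁆ = 0) {a : S.carrier}
    (ha : a ∈ op.lieKer) (t : L) : op.i t a ∈ op.lieKer := by
  rw [mem_lieKer] at *
  intro x
  have h := op.i_lie x t a
  rw [habl, add_comm (op.i x (S.d a)), ha x] at h
  simp only [map_zero, LinearMap.zero_apply, sub_zero] at h
  rw [add_comm]; exact h.symm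

theorem proj_i (op : Operation L S) (p : ℕ → S.carrier →ₗ[ℝ] S.carrier)
    (hp1 : ∀ n, ∀ x ∈ S.grading n, p n x = x)
    (hp2 : ∀ m n, ∀ x ∈ S.grading m, m ≠ n → p n x = 0) (t : L) (n : ℕ) (a : S.carrier) :
    p n (op.i t a) = op.i t (p (n + 1) a) := by
  refine S.induct (P := fun a => p n (op.i t a) = op.i t (p (n + 1) a)) ?_ ?_ a
  · intro m a ha
    cases m with
    | zero => rw [op.i_zero t ha, hp2 0 (n + 1) a ha (by omega)]; simp
    | succ k =>
      by_cases hk : k = n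
      · subst hk
        rw [hp1 _ _ (op.i_mem t ha), hp1 _ _ ha]
      · rw [hp2 k n _ (op.i_mem t ha) hk, hp2 (k + 1) (n + 1) a ha (by omega)]; simp
  · intro a b ha hb
    simp only [map_add, ha, hb]

theorem proj_lie (op : Operation L S) (p : ℕ → S.carrier →ₗ[ℝ] S.carrier)
    (hp1 : ∀ n, ∀ x ∈ S.grading n, p n x = x)
    (hp2 : ∀ m n, ∀ x ∈ S.grading m, m ≠ n → p n x = 0) (t : L) (n : ℕ) (a : S.carrier) :
    p n (S.d (op.i t a) + op.i t (S.d a)) = S.d (op.i t (p n a)) + op.i t (S.d (p n a)) := by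
  refine S.induct (P := fun a => p n (S.d (op.i t a) + op.i t (S.d a)) =
    S.d (op.i t (p n a)) + op.i t (S.d (p n a))) ?_ ?_ a
  · intro m a ha
    have hmem : S.d (op.i t a) + op.i t (S.d a) ∈ S.grading m := by
      refine Submodule.add_mem _ ?_ (op.i_mem t (S.d_mem ha))
      cases m with
      | zero => rw [op.i_zero t ha]; simp
      | succ k => exact S.d_mem (op.i_mem t ha)
    by_cases hk : m = n
    · subst hk
      rw [hp1 _ _ hmem, hp1 _ _ ha]
    · rw [hp2 m n _ hmem hk, hp2 m n a ha hk]; simp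
  · intro a b ha hb
    simp only [map_add] at *
    rw [add_add_add_comm, ha, hb, add_add_add_comm]

/-- A basic element lies in any submodule containing the homogeneous basic elements. -/
theorem mem_of_basic (op : Operation L S) (R : Submodule ℝ S.carrier)
    (hR : ∀ n, S.grading n ⊓ op.lieKer ⊓ op.iKer ≤ R) {a : S.carrier}
    (h1 : a ∈ op.lieKer) (h2 : a ∈ op.iKer) : a ∈ R := by
  obtain ⟨p, hp0, hp1, hp2, hp3⟩ := S.exists_proj
  rw [mem_lieKer] at h1
  rw [mem_iKer] at h2
  refine hp3 R a fun n => hR n (Submodule.mem_inf.mpr ⟨Submodule.mem_inf.mpr ⟨hp0 n a, ?_⟩, ?_⟩)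
  · rw [mem_lieKer]
    intro t
    rw [← op.proj_lie p hp1 hp2, h1 t, map_zero]
  · rw [mem_iKer]
    intro t
    cases n with
    | zero => exact op.i_zero t (hp0 0 a)
    | succ n => rw [← op.proj_i p hp1 hp2, h2 t, map_zero]

/-- Invariant elements killed by `i (b j)` for `j` outside `T`. -/
def partialKer (op : Operation L S) {ι : Type} (b : ι → L) (T : Finset ι) :
    Submodule ℝ S.carrier :=
  op.lieKer ⊓ ⨅ j : {j // j ∉ T}, LinearMap.ker (op.i (b j))

theorem mem_partialKer (op : Operation L S) {ι : Type} (b : ι → L) (T : Finset ι)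
    {a : S.carrier} :
    a ∈ op.partialKer b T ↔ a ∈ op.lieKer ∧ ∀ j, j ∉ T → op.i (b j) a = 0 := by
  simp [partialKer]

theorem partialKer_mul (op : Operation L S) {ι : Type} (b : ι → L) (T : Finset ι)
    (m : ℕ) (x y : S.carrier) (hm : x ∈ S.grading m) (hx : x ∈ op.partialKer b T)
    (hy : y ∈ op.partialKer b T) : x * y ∈ op.partialKer b T := by
  rw [mem_partialKer] at *
  refine ⟨op.lieKer_mul hm hx.1 hy.1, fun j hj => ?_⟩
  rw [op.i_antider _ hm, hx.2 j hj, hy.2 j hj]; simp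

theorem partialKer_d (op : Operation L S) {ι : Type} (b : ι → L) (T : Finset ι)
    (x : S.carrier) (hx : x ∈ op.partialKer b T) : S.d x ∈ op.partialKer b T := by
  rw [mem_partialKer] at *
  refine ⟨op.lieKer_d hx.1, fun j hj => ?_⟩
  have := (op.mem_lieKer.mp hx.1) (b j)
  rw [hx.2 j hj] at this
  simpa using this

end Operation

/-- for an operation of a finite-dimensional abelian Lie algebra `g`
in a CDGA `A` admitting an algebraic connection `χ`, the canonical map
`(A_{i,L} ⊗ ∧g*, d_χ̄) → (A_L, d)`, `a ⊗ α₁ ∧ … ∧ α_k ↦ a·χ(α₁)⋯χ(α_k)`, is an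
isomorphism of CDGAs; here `KL` realizes `A_L`, `KiL` realizes `A_{i,L}` and `Φ` is
the canonical map. -/
theorem statement11 {L : Type} [LieRing L] [LieAlgebra ℝ L] [Module.Finite ℝ L]
    (habl : ∀ x y : L, ⁅x, y⁆ = 0)
    (A : CDGA) (op : Operation L A) (χ : AlgConnection op)
    (KL : CDGA) (κL : CDGAHom KL A) (hκLinj : Function.Injective κL.toLin)
    (hκL : ∀ n, (KL.grading n).map κL.toLin = A.grading n ⊓ op.lieKer)
    (KiL : CDGA) (κiL : CDGAHom KiL A) (hκiLinj : Function.Injective κiL.toLin)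
    (hκiL : ∀ n, (KiL.grading n).map κiL.toLin = A.grading n ⊓ op.lieKer ⊓ op.iKer)
    (μ : CDGAHom KiL KL) (hμ : ∀ a, κL.toLin (μ.toLin a) = κiL.toLin a)
    (χL : Module.Dual ℝ L →ₗ[ℝ] KL.carrier) (hχL : ∀ α, κL.toLin (χL α) = χ.χ α)
    (fK : Module.Dual ℝ L →ₗ[ℝ] KiL.carrier)
    (hfK : ∀ α, κiL.toLin (fK α) = A.d (χ.χ α))
    (E : CDGA) (hE : IsHirschExtDeg1 KiL (Module.Dual ℝ L) fK E)
    (Φ : CDGAHom E KL) (hΦι : ∀ a, Φ.toLin (hE.incl.toLin a) = μ.toLin a)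
    (hΦj : ∀ α, Φ.toLin (hE.j α) = χL α) :
    Φ.IsIso := by
  classical
  -- the inverse of the inclusion of the basic subalgebra
  obtain ⟨g, hg⟩ := κiL.toLin.exists_leftInverse_of_injective (LinearMap.ker_eq_bot.mpr hκiLinj)
  have hg' : ∀ a, g (κiL.toLin a) = a := fun a => LinearMap.congr_fun hg a
  have hKL : ∀ a, κL.toLin a ∈ op.lieKer := by
    refine KL.induct ?_ ?_
    · intro n a ha
      have : κL.toLin a ∈ (KL.grading n).map κL.toLin := Submodule.mem_map_of_mem ha
      rw [hκL] at this
      exact this.2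
    · intro a b ha hb
      rw [map_add]; exact Submodule.add_mem _ ha hb
  have hKiL : ∀ a, κiL.toLin a ∈ op.lieKer ⊓ op.iKer := by
    refine KiL.induct ?_ ?_
    · intro n a ha
      have : κiL.toLin a ∈ (KiL.grading n).map κiL.toLin := Submodule.mem_map_of_mem ha
      rw [hκiL] at this
      exact ⟨this.1.2, this.2⟩
    · intro a b ha hb
      rw [map_add]; exact Submodule.add_mem _ ha hb
  -- a basis and the dual basis
  let b := Module.finBasis ℝ L
  let y : Fin (Module.finrank ℝ L) → A.carrier := fun j => χ.χ (b.coord j)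
  let c : Fin (Module.finrank ℝ L) → E.carrier := fun j => hE.j (b.coord j)
  have hiy : ∀ s t, op.i (b s) (y t) = if s = t then 1 else 0 := by
    intro s t
    simp only [y, χ.horizontal, Module.Basis.coord_apply, Module.Basis.repr_self,
      Finsupp.single_apply]
    split_ifs <;> simp
  have hyL : ∀ t, y t ∈ op.lieKer := by
    intro t
    have := hKL (χL (b.coord t))
    rwa [hχL] at this
  let θ : E.carrier →ₗ[ℝ] A.carrier := κL.toLin ∘ₗ Φ.toLin
  have hθmul : ∀ u v, θ (u * v) = θ u * θ v := by
    intro u v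
    simp [θ, Φ.map_mul, κL.map_mul]
  have hθι : ∀ a, θ (hE.incl.toLin a) = κiL.toLin a := by
    intro a
    simp [θ, hΦι, hμ]
  have hθc : ∀ t, θ (c t) = y t := by
    intro t
    simp [θ, c, hΦj, hχL, y]
  have main : ∀ T : Finset (Fin (Module.finrank ℝ L)), ∃ ψ : A.carrier →ₗ[ℝ] E.carrier,
      GoodMap A E (op.partialKer b T) ψ θ ∧ (∀ a, ψ (κiL.toLin a) = hE.incl.toLin a) ∧
      ∀ t ∈ T, ψ (y t) = c t := by
    intro T
    induction T using Finset.induction_on with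
    | empty =>
      have hrange : ∀ x ∈ op.partialKer b ∅, ∃ a, κiL.toLin a = x := by
        intro x hx
        rw [Operation.mem_partialKer] at hx
        have hxi : x ∈ op.iKer := by
          rw [Operation.mem_iKer]
          intro t
          have : op.i.flip x = 0 := b.ext fun j => by simpa using hx.2 j (by simp)
          simpa using LinearMap.congr_fun this t
        have := op.mem_of_basic (LinearMap.range κiL.toLin) (by
          intro n
          rw [← hκiL]
          exact LinearMap.map_le_range) hx.1 hxi
        simpa using this
      refine ⟨hE.incl.toLin ∘ₗ g, ⟨?_, ?_, ?_, ?_⟩, ?_, by simp⟩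
      · intro m x x' _ hx hx'
        obtain ⟨a, rfl⟩ := hrange x hx
        obtain ⟨a', rfl⟩ := hrange x' hx'
        simp [← κiL.map_mul, hg', hE.incl.map_mul]
      · intro m x hm hx
        have hx' := hx
        obtain ⟨a, rfl⟩ := hrange x hx
        have h3 := hKiL a
        have : κiL.toLin a ∈ (KiL.grading m).map κiL.toLin := by
          rw [hκiL]; exact ⟨⟨hm, h3.1⟩, h3.2⟩
        obtain ⟨a', ha', h⟩ := this
        rw [hκiLinj h] at ha'
        simpa [hg'] using hE.incl.map_grading ha'
      · intro x hx
        obtain ⟨a, rfl⟩ := hrange x hx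
        simp [← κiL.map_d, hg', hE.incl.map_d]
      · intro x hx
        obtain ⟨a, rfl⟩ := hrange x hx
        simp [hg', hθι]
      · intro a
        simp [hg']
    | insert t T ht ih =>
      obtain ⟨ψ, hψ, hψι, hψc⟩ := ih
      have hy1 : ∀ s, y s ∈ A.grading 1 := fun s => χ.mem _
      have hdy : A.d (y t) = κiL.toLin (fK (b.coord t)) := (hfK _).symm
      refine ⟨stepMap (op.i (b t)) (y t) (c t) ψ,
        goodMap_step hψ (op.i (b t)) (y t) (c t) (op.partialKer_mul b T) (op.partialKer_d b T)
          (fun a ha => ((op.mem_partialKer b T).mp ha).2 t ht) ?_ (op.i_mem (b t))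
          (op.i_zero (b t)) (op.i_antider (b t)) (hy1 t) (by simp [hiy]) ?_ (hE.j_mem _) ?_
          (hθc t) hθmul, ?_, ?_⟩
      · intro x hx
        rw [Operation.mem_partialKer] at hx
        have hix := op.lieKer_i habl hx.1 (b t)
        have h0 : ∀ j, j ∉ T → op.i (b j) (op.i (b t) x) = 0 := by
          intro j hj
          by_cases hjt : j = t
          · subst hjt; exact op.i_sq _ _
          · rw [op.i_anticomm, hx.2 j (by simp [hjt, hj])]; simp
        refine ⟨(op.mem_partialKer b T).mpr ⟨hix, h0⟩, (op.mem_partialKer b T).mpr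
          ⟨Submodule.sub_mem _ hx.1 (op.lieKer_mul (hy1 t) (hyL t) hix), ?_⟩⟩
        intro j hj
        rw [map_sub, op.i_antider _ (hy1 t), h0 j hj, hiy]
        by_cases hjt : j = t
        · subst hjt; simp
        · rw [hx.2 j (by simp [hjt, hj])]; simp [hjt]
      · rw [hdy, Operation.mem_partialKer]
        exact ⟨(hKiL _).1, fun j _ => op.mem_iKer.mp (hKiL _).2 (b j)⟩
      · rw [hdy, hψι]; exact hE.dj _
      · intro a
        rw [stepMap_apply, op.mem_iKer.mp (hKiL a).2 (b t)]
        simp [hψι]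
      · intro s hs
        rw [stepMap_apply, hiy]
        by_cases hst : t = s
        · subst hst
          have h1 : ψ 1 = 1 := by
            rw [← κiL.map_one, hψι, hE.incl.map_one]
          simp [h1]
        · have : s ∈ T := by
            rcases Finset.mem_insert.mp hs with h | h
            · exact absurd h.symm hst
            · exact h
          simp [hst, hψc s this]
  obtain ⟨ψ, hψ, hψι, hψc⟩ := main Finset.univ
  have hB : ∀ a, κL.toLin a ∈ op.partialKer b Finset.univ := by
    intro a
    rw [Operation.mem_partialKer]
    exact ⟨hKL a, by simp⟩
  have hgr : ∀ (n : ℕ) (a : KL.carrier), a ∈ KL.grading n → ψ (κL.toLin a) ∈ E.grading n :=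
    fun n a ha => hψ.gr n _ (κL.map_grading ha) (hB a)
  let Ψ : CDGAHom KL E :=
    { toLin := ψ ∘ₗ κL.toLin
      map_one := by
        rw [LinearMap.comp_apply, κL.map_one, ← κiL.map_one, hψι, hE.incl.map_one]
      map_mul := by
        intro u v
        refine KL.induct (P := fun u => (ψ ∘ₗ κL.toLin) (u * v) =
          (ψ ∘ₗ κL.toLin) u * (ψ ∘ₗ κL.toLin) v) ?_ ?_ u
        · intro n a ha
          simp only [LinearMap.comp_apply, κL.map_mul]
          exact hψ.mul n _ _ (κL.map_grading ha) (hB a) (hB v)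
        · intro a a' ha ha'
          rw [add_mul, map_add, map_add, ha, ha', add_mul]
      map_grading := fun {n a} ha => hgr n a ha
      map_d := by
        intro a
        simp only [LinearMap.comp_apply, κL.map_d]
        exact hψ.d _ (hB a) }
  have hΨ : ∀ a, Ψ.toLin a = ψ (κL.toLin a) := fun a => rfl
  have hψχ : ∀ α, ψ (χ.χ α) = hE.j α := by
    intro α
    have : ψ ∘ₗ χ.χ = hE.j := b.dualBasis.ext fun t => by
      have := hψc t (Finset.mem_univ t)
      simpa [y, c, Module.Basis.coe_dualBasis] using this
    exact LinearMap.congr_fun this α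
  let ΨΦ : CDGAHom E E :=
    { toLin := Ψ.toLin ∘ₗ Φ.toLin
      map_one := by simp [Φ.map_one, Ψ.map_one]
      map_mul := fun u v => by simp [Φ.map_mul, Ψ.map_mul]
      map_grading := fun ha => Ψ.map_grading (Φ.map_grading ha)
      map_d := fun a => by simp [Φ.map_d, Ψ.map_d] }
  let idE : CDGAHom E E :=
    { toLin := LinearMap.id
      map_one := rfl
      map_mul := fun _ _ => rfl
      map_grading := fun ha => ha
      map_d := fun _ => rfl }
  have hid : ΨΦ = idE := by
    refine (hE.universal E hE.incl hE.j hE.j_mem hE.dj).unique ⟨?_, ?_⟩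
      ⟨fun _ => rfl, fun _ => rfl⟩
    · intro a
      simp [ΨΦ, hΦι, hΨ, hμ, hψι]
    · intro α
      simp [ΨΦ, hΦj, hΨ, hχL, hψχ]
  have hleft : ∀ e, Ψ.toLin (Φ.toLin e) = e := by
    intro e
    have := congrArg (fun F : CDGAHom E E => F.toLin e) hid
    exact this
  have hright : ∀ a, Φ.toLin (Ψ.toLin a) = a := by
    intro a
    apply hκLinj
    exact hψ.inv _ (hB a)
  refine ⟨⟨Function.LeftInverse.injective hleft, Function.RightInverse.surjective hright⟩, ?_⟩
  intro n
  apply le_antisymm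
  · rintro _ ⟨e, he, rfl⟩
    exact Φ.map_grading he
  · intro a ha
    exact ⟨Ψ.toLin a, Ψ.map_grading ha, hright a⟩
end
end
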